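/- arXiv:1912.04863 — 8 statements merged into one kernel-verified Lean document; each statement's English description precedes it below -/
import Mathlib

section
/- Let n be a natural number and C a nonempty closed subset of Euclidean space ℝⁿ. Then the set Σ*(d_C) of points outside C at which the distance function d_C fails to be differentiable is locally contractible (in particular it is locally path connected). -/
open Metric Set

/-- A topological space `S` is locally contractible if every neighborhood `V` of a point `x`
contains a neighborhood `W` of `x` that can be contracted to a point inside `V`. -/
def IsLocallyContractible (S : Type*) [TopologicalSpace S] : Prop :=
  ∀ (x : S) (V : Set S), V ∈ nhds x →
    ∃ W ∈ nhds x, W ⊆ V ∧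
      ∃ F : C(W × unitInterval, V),
        (∀ w : W, ((F (w, 0) : V) : S) = (w : S)) ∧
        ∃ p : V, ∀ w : W, F (w, 1) = p

set_option linter.unusedSectionVars false

section Helpers

open Filter Topology

variable {E : Type*} [NormedAddCommGroup E] [InnerProductSpace ℝ E] [ProperSpace E]

/-- Generalized projections: `p` lies in the subdifferential of the convex function
`(‖y‖² - d²) / 2`. -/
def GenProj (C : Set E) (y p : E) : Prop :=
  ∀ z, infDist z C ^ 2 - ‖z - p‖ ^ 2 ≤ infDist y C ^ 2 - ‖y - p‖ ^ 2

/-- The resolvent relation. -/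
def Resolv (C : Set E) (s : ℝ) (x y : E) : Prop :=
  ∃ p, GenProj C y p ∧ x = y - s • (y - p)

lemma genProj_of_proj {C : Set E} {y c : E} (hc : c ∈ C) (h : infDist y C = ‖y - c‖) :
    GenProj C y c := by
  intro z
  have h1 : infDist z C ≤ ‖z - c‖ := by rw [← dist_eq_norm]; exact infDist_le_dist_of_mem hc
  have h2 : infDist z C ^ 2 ≤ ‖z - c‖ ^ 2 := pow_le_pow_left₀ infDist_nonneg h1 2
  rw [h]; linarith

lemma exists_proj {C : Set E} (hne : C.Nonempty) (hC : IsClosed C) (y : E) :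
    ∃ c ∈ C, infDist y C = ‖y - c‖ := by
  obtain ⟨c, hc, h⟩ := hC.exists_infDist_eq_dist hne y
  exact ⟨c, hc, by rw [h, dist_eq_norm]⟩

lemma genProj_concave {C : Set E} (hne : C.Nonempty) (hC : IsClosed C) (p y z : E) {t : ℝ}
    (ht0 : 0 ≤ t) (ht1 : t ≤ 1) :
    (1 - t) * (infDist y C ^ 2 - ‖y - p‖ ^ 2) + t * (infDist z C ^ 2 - ‖z - p‖ ^ 2) ≤
      infDist (y + t • (z - y)) C ^ 2 - ‖y + t • (z - y) - p‖ ^ 2 := by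
  obtain ⟨c, hc, h⟩ := exists_proj hne hC (y + t • (z - y))
  have key : ∀ w, infDist w C ^ 2 ≤ ‖w - c‖ ^ 2 := fun w =>
    pow_le_pow_left₀ infDist_nonneg (by rw [← dist_eq_norm]; exact infDist_le_dist_of_mem hc) 2
  have hy := mul_le_mul_of_nonneg_left (key y) (sub_nonneg.2 ht1)
  have hz := mul_le_mul_of_nonneg_left (key z) ht0
  have id1 : ∀ q : E, ‖y + t • (z - y) - q‖ ^ 2 =
      (1 - t) * ‖y - q‖ ^ 2 + t * ‖z - q‖ ^ 2 - t * (1 - t) * ‖z - y‖ ^ 2 := by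
    intro q
    have e1 : y + t • (z - y) - q = (y - q) + t • (z - y) := by abel
    have e2 : z - q = (y - q) + (z - y) := by abel
    rw [e1, e2, norm_add_sq_real, norm_add_sq_real, norm_smul, inner_smul_right, mul_pow,
      Real.norm_eq_abs, sq_abs]
    ring
  rw [h, id1 c, id1 p]
  linarith

lemma exists_resolv {C : Set E} (hne : C.Nonempty) (hC : IsClosed C) {s : ℝ}
    (hs0 : 0 ≤ s) (hs1 : s < 1) (x : E) : ∃ y, Resolv C s x y := by
  rcases hs0.eq_or_lt with rfl | hs
  · obtain ⟨c, hc, h⟩ := exists_proj hne hC x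
    exact ⟨x, c, genProj_of_proj hc h, by simp⟩
  have h1s : 0 < 1 - s := by linarith
  set d := infDist x C with hd
  have hd0 : 0 ≤ d := infDist_nonneg
  set R := 2 * s * d / (1 - s) with hR
  have hR0 : 0 ≤ R := by positivity
  have hcont : Continuous (fun z => s * infDist z C ^ 2 - ‖z - x‖ ^ 2) := by
    have := continuous_infDist_pt C
    fun_prop
  obtain ⟨y, -, hy⟩ := (isCompact_closedBall x R).exists_isMaxOn
    ⟨x, mem_closedBall_self hR0⟩ hcont.continuousOn
  have hmax : ∀ z, s * infDist z C ^ 2 - ‖z - x‖ ^ 2 ≤ s * infDist y C ^ 2 - ‖y - x‖ ^ 2 := by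
    intro z
    by_cases hz : z ∈ closedBall x R
    · exact hy hz
    · have hx := hy (mem_closedBall_self hR0)
      simp only [mem_ofPred_eq, sub_self, norm_zero] at hx
      refine le_trans ?_ hx
      rw [mem_closedBall, not_le, dist_eq_norm, hR, div_lt_iff₀ h1s] at hz
      have h1 : infDist z C ≤ d + ‖z - x‖ := by
        have := infDist_le_infDist_add_dist (s := C) (x := z) (y := x)
        rwa [dist_eq_norm] at this
      have h2 : infDist z C ^ 2 ≤ (d + ‖z - x‖) ^ 2 := pow_le_pow_left₀ infDist_nonneg h1 2
      have h3 := mul_le_mul_of_nonneg_left h2 hs.le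
      have h4 := mul_le_mul_of_nonneg_left hz.le (norm_nonneg (z - x))
      nlinarith
  set p : E := y - s⁻¹ • (y - x) with hp
  have hxp : x = y - s • (y - p) := by
    rw [hp, sub_sub_cancel, smul_smul, mul_inv_cancel₀ hs.ne', one_smul, sub_sub_cancel]
  refine ⟨y, p, ?_, hxp⟩
  have hid : ∀ z, s * ‖z - p‖ ^ 2 - ‖z - x‖ ^ 2 + (1 - s) * ‖z - y‖ ^ 2 =
      s * ‖y - p‖ ^ 2 - ‖y - x‖ ^ 2 := by
    intro z
    have e1 : z - p = (z - y) + (y - p) := by abel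
    have e2 : z - x = (z - y) + s • (y - p) := by rw [hxp]; abel
    have e3 : y - x = s • (y - p) := by rw [hxp]; abel
    rw [e1, e2, e3, norm_add_sq_real, norm_add_sq_real, norm_smul, inner_smul_right, mul_pow,
      Real.norm_eq_abs, sq_abs]
    ring
  intro z
  by_contra hlt
  rw [not_le] at hlt
  set gz := infDist z C ^ 2 - ‖z - p‖ ^ 2 with hgz
  set gy := infDist y C ^ 2 - ‖y - p‖ ^ 2 with hgy
  have hA : ∀ t : ℝ, 0 < t → t ≤ 1 → s * (gz - gy) ≤ (1 - s) * ‖z - y‖ ^ 2 * t := by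
    intro t ht0 ht1
    have h1 := genProj_concave hne hC p y z ht0.le ht1
    have h2 := hmax (y + t • (z - y))
    have h3 := hid (y + t • (z - y))
    have h4 : ‖y + t • (z - y) - y‖ ^ 2 = t ^ 2 * ‖z - y‖ ^ 2 := by
      rw [add_sub_cancel_left, norm_smul, mul_pow, Real.norm_eq_abs, sq_abs]
    rw [h4] at h3
    rw [← hgz, ← hgy] at h1
    have h5 := mul_le_mul_of_nonneg_left h1 hs.le
    have h6 : s * gy = s * infDist y C ^ 2 - s * ‖y - p‖ ^ 2 := by rw [hgy]; ring
    have h7 : t * (s * (gz - gy)) ≤ t * ((1 - s) * ‖z - y‖ ^ 2 * t) := by nlinarith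
    exact le_of_mul_le_mul_left h7 ht0
  have hpos : 0 < s * (gz - gy) := mul_pos hs (by linarith)
  set B := (1 - s) * ‖z - y‖ ^ 2 with hB
  have hB0 : 0 ≤ B := by positivity
  set a := s * (gz - gy)
  have h1 := hA (min 1 (a / (2 * (B + 1)))) (by positivity) (min_le_left _ _)
  have h2 : B * min 1 (a / (2 * (B + 1))) ≤ B * (a / (2 * (B + 1))) :=
    mul_le_mul_of_nonneg_left (min_le_right _ _) hB0
  have h3 : B * (a / (2 * (B + 1))) < a := by
    rw [← mul_div_assoc, div_lt_iff₀ (by positivity)]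
    nlinarith
  linarith

lemma genProj_mono {C : Set E} {y p y' p' : E} (h : GenProj C y p) (h' : GenProj C y' p') :
    0 ≤ inner ℝ (p - p') (y - y') := by
  have h1 := h y'
  have h2 := h' y
  have e1 : ‖y - p‖ ^ 2 = ‖(y - y') + (y' - p)‖ ^ 2 := by congr 2; abel
  have e2 : ‖y - p'‖ ^ 2 = ‖(y - y') + (y' - p')‖ ^ 2 := by congr 2; abel
  rw [norm_add_sq_real] at e1 e2
  have e3 : inner ℝ (y - y') (y' - p') - inner ℝ (y - y') (y' - p) =
      inner ℝ (p - p') (y - y') := by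
    rw [← inner_sub_right, real_inner_comm]; congr 1; abel
  linarith

lemma resolv_est {C : Set E} {s s' : ℝ} {x x' y y' p' : E} (hs : 0 ≤ s)
    (h : Resolv C s x y) (h' : GenProj C y' p') (hx' : x' = y' - s' • (y' - p')) :
    (1 - s) * ‖y - y'‖ ≤ ‖x - x'‖ + |s - s'| * ‖y' - p'‖ := by
  obtain ⟨p, hp, hx⟩ := h
  have hm := mul_nonneg hs (genProj_mono hp h')
  have e : x - x' + (s - s') • (y' - p') = (1 - s) • (y - y') + s • (p - p') := by
    rw [hx, hx']; module
  have h1 : inner ℝ (x - x' + (s - s') • (y' - p')) (y - y') =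
      (1 - s) * ‖y - y'‖ ^ 2 + s * inner ℝ (p - p') (y - y') := by
    rw [e, inner_add_left, real_inner_smul_left, real_inner_smul_left, real_inner_self_eq_norm_sq]
  have h2 := real_inner_le_norm (x - x' + (s - s') • (y' - p')) (y - y')
  have h3 : ‖x - x' + (s - s') • (y' - p')‖ ≤ ‖x - x'‖ + |s - s'| * ‖y' - p'‖ := by
    refine (norm_add_le _ _).trans ?_
    rw [norm_smul, Real.norm_eq_abs]
  rcases (norm_nonneg (y - y')).eq_or_lt with h0 | h0
  · rw [← h0, mul_zero]; positivity
  · have h4 : (1 - s) * ‖y - y'‖ * ‖y - y'‖ ≤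
        (‖x - x'‖ + |s - s'| * ‖y' - p'‖) * ‖y - y'‖ := by
      have := mul_le_mul_of_nonneg_right h3 h0.le
      nlinarith
    exact le_of_mul_le_mul_right h4 h0

/-- A continuous selection of the resolvent. -/
lemma exists_flow {C : Set E} (hne : C.Nonempty) (hC : IsClosed C) :
    ∃ F : ℝ × E → E, ContinuousOn F (Ico 0 1 ×ˢ univ) ∧
      ∀ s x, 0 ≤ s → s < 1 → Resolv C s x (F (s, x)) := by
  have hex : ∀ q : ℝ × E, ∃ y, 0 ≤ q.1 → q.1 < 1 → Resolv C q.1 q.2 y := by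
    intro q
    by_cases h : 0 ≤ q.1 ∧ q.1 < 1
    · obtain ⟨y, hy⟩ := exists_resolv hne hC h.1 h.2 q.2
      exact ⟨y, fun _ _ => hy⟩
    · exact ⟨0, fun h1 h2 => absurd ⟨h1, h2⟩ h⟩
  choose F hF using hex
  refine ⟨F, ?_, fun s x => hF (s, x)⟩
  rintro ⟨s', x'⟩ ⟨⟨h0, h1⟩, -⟩
  obtain ⟨p', hp', hx'⟩ := hF (s', x') h0 h1
  simp only at h0 h1 hx'
  set y' := F (s', x')
  rw [ContinuousWithinAt, tendsto_iff_norm_sub_tendsto_zero]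
  have hlim : Tendsto (fun q : ℝ × E => (‖q.2 - x'‖ + |q.1 - s'| * ‖y' - p'‖) / (1 - q.1))
      (𝓝[Ico 0 1 ×ˢ univ] (s', x')) (𝓝 0) := by
    have hc : ContinuousAt (fun q : ℝ × E =>
        (‖q.2 - x'‖ + |q.1 - s'| * ‖y' - p'‖) / (1 - q.1)) (s', x') := by
      apply ContinuousAt.div
      · fun_prop
      · fun_prop
      · simp only; linarith
    have := hc.tendsto
    simp only [sub_self, norm_zero, abs_zero, zero_mul, add_zero, zero_div] at this
    exact this.mono_left nhdsWithin_le_nhds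
  refine squeeze_zero' (Eventually.of_forall fun _ => norm_nonneg _) ?_ hlim
  filter_upwards [self_mem_nhdsWithin] with q hq
  have hq1 : 0 < 1 - q.1 := by linarith [hq.1.2]
  rw [le_div_iff₀ hq1, mul_comm]
  exact resolv_est hq.1.1 (hF q hq.1.1 hq.1.2) hp' hx'

lemma genProj_unique {C : Set E} {y p c : E} (hd : DifferentiableAt ℝ (fun z => infDist z C) y)
    (hp : GenProj C y p) (hc : GenProj C y c) : p = c := by
  have key : ∀ q, GenProj C y q → ∀ v,
      fderiv ℝ (fun z => infDist z C ^ 2) y v = 2 * inner ℝ (y - q) v := by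
    intro q hq v
    have h1 : HasFDerivAt (fun z => infDist z C ^ 2) (fderiv ℝ (fun z => infDist z C ^ 2) y) y :=
      (hd.pow 2).hasFDerivAt
    have h2 : HasFDerivAt (fun z : E => ‖z - q‖ ^ 2) _ y :=
      ((hasFDerivAt_id y).sub_const q).norm_sq
    have h3 := (h1.sub h2)
    have hmax : IsLocalMax (fun z => infDist z C ^ 2 - ‖z - q‖ ^ 2) y :=
      Eventually.of_forall hq
    have h4 := hmax.hasFDerivAt_eq_zero h3
    have h5 := DFunLike.congr_fun h4 v
    simp at h5
    rw [inner_sub_left]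
    linarith
  have h := fun v => (key p hp v).symm.trans (key c hc v)
  have h1 := h (c - p)
  have h2 : inner ℝ (c - p) (c - p) = (0 : ℝ) := by
    have : inner ℝ (c - p) (c - p) = inner ℝ (y - p) (c - p) - inner ℝ (y - c) (c - p) := by
      rw [← inner_sub_left]; congr 1; abel
    rw [this]; linarith
  exact (sub_eq_zero.1 (inner_self_eq_zero.1 h2)).symm

lemma diff_squeeze {l u f : E → ℝ} {x : E} (hl : DifferentiableAt ℝ l x)
    (hu : DifferentiableAt ℝ u x) (h1 : ∀ z, l z ≤ f z) (h2 : ∀ z, f z ≤ u z)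
    (e1 : l x = f x) (e2 : f x = u x) : DifferentiableAt ℝ f x := by
  have hmin : IsLocalMin (fun z => u z - l z) x := by
    refine Eventually.of_forall fun z => ?_
    simp only
    have := h1 z; have := h2 z; linarith
  have h0 := hmin.hasFDerivAt_eq_zero (hu.hasFDerivAt.sub hl.hasFDerivAt)
  have hul : fderiv ℝ u x = fderiv ℝ l x := sub_eq_zero.1 h0
  have hu' := hu.hasFDerivAt
  have hl' := hl.hasFDerivAt
  rw [← hul] at hl'
  have : HasFDerivAt f (fderiv ℝ u x) x := by
    rw [hasFDerivAt_iff_isLittleO] at hu' hl' ⊢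
    refine (Asymptotics.IsBigO.of_bound 1 (Eventually.of_forall fun z => ?_)).trans_isLittleO
      (hu'.norm_left.add hl'.norm_left)
    have a1 := h1 z
    have a2 := h2 z
    simp only [Real.norm_eq_abs, one_mul]
    refine le_trans ?_ (le_abs_self _)
    rw [abs_le]
    constructor
    · have := neg_abs_le (l z - l x - (fderiv ℝ u x) (z - x))
      have := abs_nonneg (u z - u x - (fderiv ℝ u x) (z - x))
      linarith
    · have := le_abs_self (u z - u x - (fderiv ℝ u x) (z - x))
      have := abs_nonneg (l z - l x - (fderiv ℝ u x) (z - x))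
      linarith
  exact this.differentiableAt

/-- interior points of a minimizing segment are points of differentiability -/
lemma diff_of_segment {C : Set E} {y c : E} {s : ℝ} (hs0 : 0 < s) (hs1 : s < 1)
    (hc : c ∈ C) (h : infDist y C = ‖y - c‖) (hyc : y ≠ c) :
    DifferentiableAt ℝ (fun z => infDist z C) (y - s • (y - c)) := by
  set x := y - s • (y - c) with hx
  have hn : 0 < ‖y - c‖ := norm_pos_iff.2 (sub_ne_zero.2 hyc)
  have ex : x - c = (1 - s) • (y - c) := by rw [hx]; module
  have ey : x - y = (-s) • (y - c) := by rw [hx]; module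
  have nx : ‖x - c‖ = (1 - s) * ‖y - c‖ := by
    rw [ex, norm_smul, Real.norm_eq_abs, abs_of_pos (by linarith)]
  have ny : ‖x - y‖ = s * ‖y - c‖ := by
    rw [ey, norm_smul, Real.norm_eq_abs, abs_neg, abs_of_pos hs0]
  have hxc : x - c ≠ 0 := by
    rw [← norm_pos_iff, nx]; exact mul_pos (by linarith) hn
  have hxy : x - y ≠ 0 := by
    rw [← norm_pos_iff, ny]; exact mul_pos hs0 hn
  have hu : ∀ z, infDist z C ≤ ‖z - c‖ := fun z => by
    rw [← dist_eq_norm]; exact infDist_le_dist_of_mem hc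
  have hl : ∀ z, ‖y - c‖ - ‖z - y‖ ≤ infDist z C := fun z => by
    have := infDist_le_infDist_add_dist (s := C) (x := y) (y := z)
    rw [dist_comm, dist_eq_norm, h] at this
    linarith
  have e : infDist x C = (1 - s) * ‖y - c‖ := by
    apply le_antisymm
    · rw [← nx]; exact hu x
    · have := hl x
      rw [ny] at this; linarith
  refine diff_squeeze (l := fun z => ‖y - c‖ - ‖z - y‖) (u := fun z => ‖z - c‖) ?_ ?_ hl hu ?_ ?_
  · exact (((differentiableAt_id.sub_const y).norm ℝ hxy)).const_sub _
  · exact (differentiableAt_id.sub_const c).norm ℝ hxc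
  · rw [ny, e]; ring
  · rw [nx, e]

lemma resolv_notMem {C : Set E} (hne : C.Nonempty) (hC : IsClosed C) {s : ℝ} {x y : E}
    (h : Resolv C s x y) (hx : x ∉ C) : y ∉ C := by
  intro hy
  obtain ⟨p, hp, hxp⟩ := h
  have h1 := hp p
  rw [infDist_zero_of_mem hy, sub_self, norm_zero] at h1
  have h2 : ‖y - p‖ = 0 := by
    have := sq_nonneg (infDist p C)
    have := sq_nonneg ‖y - p‖
    have : ‖y - p‖ ^ 2 = 0 := by linarith
    exact pow_eq_zero_iff (two_ne_zero) |>.1 this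
  rw [norm_eq_zero] at h2
  rw [h2, smul_zero, sub_zero] at hxp
  exact hx (hxp ▸ hy)

lemma resolv_sing {C : Set E} (hne : C.Nonempty) (hC : IsClosed C) {s : ℝ} {x y : E}
    (h : Resolv C s x y) (hs : 0 < s)
    (hd : DifferentiableAt ℝ (fun z => infDist z C) y) :
    y - s⁻¹ • (y - x) ∈ C ∧ infDist y C = ‖s⁻¹ • (y - x)‖ := by
  obtain ⟨p, hp, hxp⟩ := h
  obtain ⟨c, hc, e⟩ := exists_proj hne hC y
  have hpc := genProj_unique hd hp (genProj_of_proj hc e)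
  subst hpc
  have : s⁻¹ • (y - x) = y - p := by
    rw [hxp, sub_sub_cancel, smul_smul, inv_mul_cancel₀ hs.ne', one_smul]
  rw [this, sub_sub_cancel]
  exact ⟨hc, e⟩

lemma diff_of_bad {C : Set E} {s : ℝ} {x y : E} (hs0 : 0 < s) (hs1 : s < 1) (hy : y ∉ C)
    (h1 : y - s⁻¹ • (y - x) ∈ C) (h2 : infDist y C = ‖s⁻¹ • (y - x)‖) :
    DifferentiableAt ℝ (fun z => infDist z C) x := by
  have := diff_of_segment (y := y) hs0 hs1 h1 (by rw [sub_sub_cancel]; exact h2)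
    (fun e => hy (by rw [e]; exact h1))
  rwa [sub_sub_cancel, smul_smul, mul_inv_cancel₀ hs0.ne', one_smul, sub_sub_cancel] at this

lemma resolv_zero {C : Set E} {x y : E} (h : Resolv C 0 x y) : y = x := by
  obtain ⟨p, -, h⟩ := h
  simpa using h.symm

theorem main_aux (C : Set E) (hne : C.Nonempty) (hC : IsClosed C) :
    IsLocallyContractible
      {x : E | x ∉ C ∧ ¬ DifferentiableAt ℝ (fun y => Metric.infDist y C) x} := by
  intro x0 V hV
  obtain ⟨F, hFc, hF⟩ := exists_flow hne hC
  have hx0C : (x0 : E) ∉ C := x0.2.1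
  obtain ⟨ε, hε, hεV⟩ := Metric.mem_nhds_iff.1 hV
  have hF0 : ∀ x, F (0, x) = x := fun x => resolv_zero (hF 0 x le_rfl one_pos)
  -- choose the time and the first radius
  have hcw := hFc (0, (x0 : E)) ⟨⟨le_rfl, one_pos⟩, mem_univ _⟩
  rw [Metric.continuousWithinAt_iff] at hcw
  obtain ⟨η, hη, hηF⟩ := hcw ε hε
  rw [hF0] at hηF
  set t : ℝ := min (1 / 2) (η / 2) with ht
  have ht0 : 0 < t := by positivity
  have ht1 : t < 1 := lt_of_le_of_lt (min_le_left _ _) (by norm_num)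
  have htη : t < η := lt_of_le_of_lt (min_le_right _ _) (by linarith)
  have hnear : ∀ s x, 0 ≤ s → s ≤ t → dist x (x0 : E) < η → dist (F (s, x)) (x0 : E) < ε := by
    intro s x h0 h1 h2
    refine hηF (x := (s, x)) ⟨⟨h0, by simp only; linarith⟩, mem_univ _⟩ ?_
    rw [Prod.dist_eq, max_lt_iff]
    refine ⟨?_, h2⟩
    rw [Real.dist_eq, sub_zero, abs_of_nonneg h0]; linarith
  -- the time-t map
  have hft : Continuous (fun x => F (t, x)) :=
    hFc.comp_continuous (by fun_prop) (fun x => ⟨⟨ht0.le, ht1⟩, mem_univ _⟩)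
  set K : Set E := {x | F (t, x) - t⁻¹ • (F (t, x) - x) ∈ C ∧
    infDist (F (t, x)) C = ‖t⁻¹ • (F (t, x) - x)‖} with hK
  have hKc : IsClosed K := by
    apply IsClosed.inter
    · exact hC.preimage (hft.sub ((hft.sub continuous_id).const_smul t⁻¹))
    · exact isClosed_eq ((continuous_infDist_pt C).comp hft) ((hft.sub continuous_id).const_smul t⁻¹).norm
  have hx0K : (x0 : E) ∉ K := fun h =>
    x0.2.2 (diff_of_bad ht0 ht1 (resolv_notMem hne hC (hF t x0 ht0.le ht1) hx0C) h.1 h.2)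
  have hopen : (Kᶜ ∩ Cᶜ) ∈ 𝓝 (x0 : E) :=
    (hKc.isOpen_compl.inter hC.isOpen_compl).mem_nhds ⟨hx0K, hx0C⟩
  obtain ⟨δ', hδ', hδK⟩ := Metric.mem_nhds_iff.1 hopen
  set δ := min δ' (min η ε) with hδ
  have hδ0 : 0 < δ := by positivity
  have hδ1 : δ ≤ δ' := min_le_left _ _
  have hδ2 : δ ≤ η := (min_le_right _ _).trans (min_le_left _ _)
  have hδ3 : δ ≤ ε := (min_le_right _ _).trans (min_le_right _ _)
  have hsing1 : ∀ x, dist x (x0 : E) < δ →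
      F (t, x) ∈ {x : E | x ∉ C ∧ ¬ DifferentiableAt ℝ (fun y => Metric.infDist y C) x} := by
    intro x hx
    have hx' := hδK (show x ∈ ball (x0 : E) δ' from lt_of_lt_of_le hx hδ1)
    exact ⟨resolv_notMem hne hC (hF t x ht0.le ht1) hx'.2,
      fun hd => hx'.1 (resolv_sing hne hC (hF t x ht0.le ht1) ht0 hd)⟩
  have hsing2 : ∀ s x, 0 ≤ s → s < 1 →
      x ∈ {x : E | x ∉ C ∧ ¬ DifferentiableAt ℝ (fun y => Metric.infDist y C) x} →
      F (s, x) ∈ {x : E | x ∉ C ∧ ¬ DifferentiableAt ℝ (fun y => Metric.infDist y C) x} := by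
    intro s x h0 h1 hx
    rcases h0.eq_or_lt with rfl | h0
    · rwa [hF0]
    have hy := resolv_notMem hne hC (hF s x h0.le h1) hx.1
    refine ⟨hy, fun hd => hx.2 ?_⟩
    have := resolv_sing hne hC (hF s x h0.le h1) h0 hd
    exact diff_of_bad h0 h1 hy this.1 this.2
  have hdist : ∀ (w : E) (r : ℝ), dist w (x0 : E) < δ → 0 ≤ r → r ≤ 1 →
      dist (w + max 0 (2 * r - 1) • ((x0 : E) - w)) (x0 : E) < δ := by
    intro w r hw h0 h1
    set m := max 0 (2 * r - 1)
    have hm0 : 0 ≤ m := le_max_left _ _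
    have hm1 : m ≤ 1 := max_le zero_le_one (by linarith)
    have e : w + m • ((x0 : E) - w) - x0 = (1 - m) • (w - x0) := by module
    rw [dist_eq_norm] at hw ⊢
    rw [e, norm_smul, Real.norm_eq_abs, abs_of_nonneg (by linarith)]
    have := norm_nonneg (w - (x0 : E))
    nlinarith
  have hmin : ∀ r : ℝ, 0 ≤ r → 0 ≤ t * min 1 (2 * r) ∧ t * min 1 (2 * r) ≤ t := by
    intro r h0
    constructor
    · positivity
    · exact mul_le_of_le_one_right ht0.le (min_le_left _ _)
  let H : E × ℝ → E := fun q =>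
    F (t * min 1 (2 * q.2), q.1 + max 0 (2 * q.2 - 1) • ((x0 : E) - q.1))
  have hHsing : ∀ (w : E) (r : ℝ),
      w ∈ {x : E | x ∉ C ∧ ¬ DifferentiableAt ℝ (fun y => Metric.infDist y C) x} →
      dist w (x0 : E) < δ → 0 ≤ r → r ≤ 1 →
      H (w, r) ∈ {x : E | x ∉ C ∧ ¬ DifferentiableAt ℝ (fun y => Metric.infDist y C) x} := by
    intro w r hw hd h0 h1
    simp only [H]
    rcases le_total r (1 / 2) with hr | hr
    · rw [max_eq_left (by linarith : 2 * r - 1 ≤ 0), zero_smul, add_zero]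
      exact hsing2 _ _ (hmin r h0).1 (lt_of_le_of_lt (hmin r h0).2 ht1) hw
    · have := hsing1 _ (hdist w r hd h0 h1)
      rwa [min_eq_left (by linarith : 1 ≤ 2 * r), mul_one]
  have hHnear : ∀ (w : E) (r : ℝ), dist w (x0 : E) < δ → 0 ≤ r → r ≤ 1 →
      dist (H (w, r)) (x0 : E) < ε := fun w r hd h0 h1 =>
    hnear _ _ (hmin r h0).1 (hmin r h0).2 (lt_of_lt_of_le (hdist w r hd h0 h1) hδ2)
  refine ⟨ball x0 δ, ball_mem_nhds _ hδ0, (ball_subset_ball hδ3).trans hεV, ?_⟩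
  refine ⟨⟨fun q => ⟨⟨H (((q.1 : _) : E), (q.2 : ℝ)),
    hHsing _ _ q.1.1.2 q.1.2 q.2.2.1 q.2.2.2⟩,
    hεV (hHnear _ _ q.1.2 q.2.2.1 q.2.2.2)⟩, ?_⟩, ?_, ?_⟩
  · refine Continuous.subtype_mk (Continuous.subtype_mk ?_ _) _
    refine hFc.comp_continuous (by fun_prop) (fun q => ⟨⟨(hmin _ q.2.2.1).1,
      lt_of_le_of_lt (hmin _ q.2.2.1).2 ht1⟩, mem_univ _⟩)
  · intro w
    apply Subtype.ext
    simp [H, hF0]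
  · refine ⟨⟨⟨F (t, x0), hsing1 _ (by simpa using hδ0)⟩,
      hεV (hnear t x0 ht0.le le_rfl (by simpa using hη))⟩, fun w => ?_⟩
    apply Subtype.ext
    apply Subtype.ext
    simp only [H, ContinuousMap.coe_mk, Set.Icc.coe_one]
    norm_num

end Helpers

/-- The set of points outside a nonempty closed set `C ⊆ ℝⁿ` where the distance function to `C`
fails to be differentiable is locally contractible. -/
theorem sigma_star_distFun_locallyContractible (n : ℕ)
    (C : Set (EuclideanSpace ℝ (Fin n))) (hne : C.Nonempty) (hC : IsClosed C) :
    IsLocallyContractible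
      {x : EuclideanSpace ℝ (Fin n) |
        x ∉ C ∧ ¬ DifferentiableAt ℝ (fun y => Metric.infDist y C) x} :=
  main_aux C hne hC
end

section
/- Let n be a natural number, C a nonempty closed subset of Euclidean space ℝⁿ, and U a connected component of ℝⁿ \ C that is bounded. Then the inclusion Σ*(d_C) ∩ U ⊆ U is a homotopy equivalence. -/
open Metric Set

/-- The inclusion of a subset `A` of a topological space `Y` is a homotopy equivalence:
there is a continuous `g : Y → A` with `g ∘ incl ≃ id_A` and `incl ∘ g ≃ id_Y`. -/
def InclusionIsHomotopyEquiv {Y : Type*} [TopologicalSpace Y] (A : Set Y) : Prop :=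
  ∃ g : C(Y, A),
    (g.comp ⟨(Subtype.val : A → Y), continuous_subtype_val⟩).Homotopic (ContinuousMap.id A) ∧
    ((⟨(Subtype.val : A → Y), continuous_subtype_val⟩ : C(A, Y)).comp g).Homotopic
      (ContinuousMap.id Y)

open Filter Topology

/-- Iterated time-concatenation of a one-step deformation. -/
def concatFlow {Y : Type*} (F : ℝ → Y → Y) : ℕ → ℝ → Y → Y
  | 0, _, x => x
  | k + 1, s, x => F (s - k) (concatFlow F k s x)

lemma concatFlow_continuous {Y : Type*} [TopologicalSpace Y] (F : ℝ → Y → Y)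
    (hF : Continuous (fun p : ℝ × Y => F p.1 p.2)) (k : ℕ) :
    Continuous (fun p : ℝ × Y => concatFlow F k p.1 p.2) := by
  induction k with
  | zero => exact continuous_snd
  | succ k ih =>
    have : Continuous (fun p : ℝ × Y => (p.1 - (k : ℝ), concatFlow F k p.1 p.2)) := by fun_prop
    exact hF.comp this

lemma concatFlow_stable {Y : Type*} (F : ℝ → Y → Y) (h0 : ∀ t ≤ 0, ∀ x, F t x = x)
    (s : ℝ) (x : Y) (k m : ℕ) (hs : s ≤ k) (hm : k ≤ m) :
    concatFlow F m s x = concatFlow F k s x := by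
  induction m, hm using Nat.le_induction with
  | base => rfl
  | succ m hm ih =>
    have : (k : ℝ) ≤ m := by exact_mod_cast hm
    rw [← ih]
    exact h0 _ (by linarith) _

lemma concatFlow_iter {Y : Type*} (F : ℝ → Y → Y) (h1 : ∀ t, 1 ≤ t → ∀ x, F t x = F 1 x)
    (s : ℝ) (x : Y) (k : ℕ) (hs : (k : ℝ) ≤ s) :
    concatFlow F k s x = (F 1)^[k] x := by
  induction k with
  | zero => rfl
  | succ k ih =>
    push_cast at hs
    rw [Function.iterate_succ_apply', ← ih (by linarith)]
    exact h1 _ (by linarith) _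

lemma concatFlow_mem {Y : Type*} (F : ℝ → Y → Y) (A : Set Y) (hA : ∀ t, ∀ x ∈ A, F t x ∈ A)
    (s : ℝ) (x : Y) (k m : ℕ) (hm : k ≤ m) (h : concatFlow F k s x ∈ A) :
    concatFlow F m s x ∈ A := by
  induction m, hm using Nat.le_induction with
  | base => exact h
  | succ m hm ih => exact hA _ _ ih

lemma inclusion_of_flow {Y : Type*} [TopologicalSpace Y] (A : Set Y) (F : ℝ → Y → Y)
    (hF : Continuous (fun p : ℝ × Y => F p.1 p.2))
    (h0 : ∀ t ≤ 0, ∀ x, F t x = x) (h1 : ∀ t, 1 ≤ t → ∀ x, F t x = F 1 x)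
    (hA : ∀ t, ∀ x ∈ A, F t x ∈ A) (τ : Y → ℝ) (hτ : Continuous τ)
    (hk : ∀ x, ∃ k : ℕ, (k : ℝ) ≤ τ x ∧ (F 1)^[k] x ∈ A) :
    InclusionIsHomotopyEquiv A := by
  let Φ : ℝ × Y → Y := fun p => concatFlow F ⌈p.1⌉₊ p.1 p.2
  have hΦeq : ∀ (N : ℕ) (p : ℝ × Y), p.1 ≤ N → Φ p = concatFlow F N p.1 p.2 := by
    intro N p hp
    exact (concatFlow_stable F h0 p.1 p.2 _ N (Nat.le_ceil _) (Nat.ceil_le.2 hp)).symm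
  have hΦ : Continuous Φ := by
    rw [continuous_iff_continuousAt]
    intro p
    obtain ⟨N, hN⟩ := exists_nat_gt p.1
    have h2 : ∀ᶠ q : ℝ × Y in 𝓝 p, q.1 < N :=
      (continuous_fst.tendsto p).eventually (gt_mem_nhds hN)
    refine ((concatFlow_continuous F hF N).continuousAt (x := p)).congr ?_
    filter_upwards [h2] with q hq
    exact (hΦeq N q hq.le).symm
  have hΦ0 : ∀ x, Φ (0, x) = x := fun x => hΦeq 0 (0, x) (by simp)
  have hΦA : ∀ s, ∀ x ∈ A, Φ (s, x) ∈ A := fun s x hx =>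
    concatFlow_mem F A hA s x 0 _ (Nat.zero_le _) hx
  have hΦ1 : ∀ x, Φ (τ x, x) ∈ A := by
    intro x
    obtain ⟨k, hk1, hk2⟩ := hk x
    refine concatFlow_mem F A hA (τ x) x k _ ?_ ?_
    · exact_mod_cast hk1.trans (Nat.le_ceil (τ x))
    · rw [concatFlow_iter F h1 _ _ _ hk1]; exact hk2
  let g : C(Y, A) := ⟨fun x => ⟨Φ (τ x, x), hΦ1 x⟩, by fun_prop⟩
  refine ⟨g, ?_, ?_⟩
  · refine ContinuousMap.Homotopic.symm ⟨⟨⟨fun p => ⟨Φ ((p.1 : ℝ) * τ p.2, p.2), hΦA _ _ p.2.2⟩, ?_⟩, ?_, ?_⟩⟩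
    · fun_prop
    · intro x; apply Subtype.ext; simp [hΦ0]
    · intro x; apply Subtype.ext; simp [g]
  · refine ContinuousMap.Homotopic.symm ⟨⟨⟨fun p => Φ ((p.1 : ℝ) * τ p.2, p.2), ?_⟩, ?_, ?_⟩⟩
    · fun_prop
    · intro x; simp [hΦ0]
    · intro x; simp [g]

section
variable {n : ℕ}

/-- `y` maximises `z ↦ t d(z)² - ‖z - x‖²`. -/
def IsArg (C : Set (EuclideanSpace ℝ (Fin n))) (t : ℝ) (x y : EuclideanSpace ℝ (Fin n)) : Prop :=
  ∀ z, t * infDist z C ^ 2 - ‖z - x‖ ^ 2 ≤ t * infDist y C ^ 2 - ‖y - x‖ ^ 2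

lemma infDist_le_add (C : Set (EuclideanSpace ℝ (Fin n))) (x y : EuclideanSpace ℝ (Fin n)) :
    infDist y C ≤ infDist x C + ‖y - x‖ := by
  rw [← dist_eq_norm]; exact infDist_le_infDist_add_dist

lemma isArg_bound (C : Set (EuclideanSpace ℝ (Fin n))) (t : ℝ) (ht : t ∈ Icc (0 : ℝ) (1 / 2))
    (x y : EuclideanSpace ℝ (Fin n))
    (h : t * infDist x C ^ 2 ≤ t * infDist y C ^ 2 - ‖y - x‖ ^ 2) :
    ‖y - x‖ ≤ 2 * infDist x C := by
  have h1 := infDist_le_add C x y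
  have h2 : 0 ≤ infDist x C := infDist_nonneg
  have h3 : 0 ≤ infDist y C := infDist_nonneg
  have h4 := norm_nonneg (y - x)
  obtain ⟨ht0, ht1⟩ := ht
  by_contra! hc
  have h5 : infDist y C ^ 2 ≤ (infDist x C + ‖y - x‖) ^ 2 := pow_le_pow_left₀ h3 h1 2
  have h6 : ‖y - x‖ ^ 2 ≤ t * (‖y - x‖ * (2 * infDist x C + ‖y - x‖)) := by
    have := mul_le_mul_of_nonneg_left h5 ht0
    nlinarith
  have h7 : t * (‖y - x‖ * (2 * infDist x C + ‖y - x‖)) ≤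
      1 / 2 * (‖y - x‖ * (2 * infDist x C + ‖y - x‖)) :=
    mul_le_mul_of_nonneg_right ht1 (by positivity)
  have h8 : 0 < ‖y - x‖ := by linarith
  nlinarith

lemma exists_isArg (C : Set (EuclideanSpace ℝ (Fin n))) (t : ℝ) (ht : t ∈ Icc (0 : ℝ) (1 / 2))
    (x : EuclideanSpace ℝ (Fin n)) : ∃ y, IsArg C t x y := by
  have hx : x ∈ closedBall x (2 * infDist x C) :=
    mem_closedBall_self (by have : 0 ≤ infDist x C := infDist_nonneg
                            positivity)
  have hc : Continuous (fun z => t * infDist z C ^ 2 - ‖z - x‖ ^ 2) := by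
    have := continuous_infDist_pt C
    fun_prop
  obtain ⟨y, -, hy⟩ := (isCompact_closedBall x (2 * infDist x C)).exists_isMaxOn ⟨x, hx⟩
    hc.continuousOn
  refine ⟨y, fun z => ?_⟩
  by_cases hz : z ∈ closedBall x (2 * infDist x C)
  · exact hy hz
  · have h1 := hy hx
    simp only [sub_self, norm_zero, mem_ofPred_eq] at h1
    by_contra! hcon
    apply hz
    rw [mem_closedBall, dist_eq_norm]
    apply isArg_bound C t ht x z
    linarith

lemma midpoint_ineq (C : Set (EuclideanSpace ℝ (Fin n))) (hne : C.Nonempty) (hC : IsClosed C)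
    (y z : EuclideanSpace ℝ (Fin n)) :
    infDist y C ^ 2 / 2 + infDist z C ^ 2 / 2 - ‖y - z‖ ^ 2 / 4 ≤
      infDist ((1 / 2 : ℝ) • (y + z)) C ^ 2 := by
  obtain ⟨c, hc, hcd⟩ := hC.exists_infDist_eq_dist hne ((1 / 2 : ℝ) • (y + z))
  have h1 : infDist y C ^ 2 ≤ ‖y - c‖ ^ 2 := by
    rw [← dist_eq_norm]; exact pow_le_pow_left₀ infDist_nonneg (infDist_le_dist_of_mem hc) 2
  have h2 : infDist z C ^ 2 ≤ ‖z - c‖ ^ 2 := by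
    rw [← dist_eq_norm]; exact pow_le_pow_left₀ infDist_nonneg (infDist_le_dist_of_mem hc) 2
  have h3 := parallelogram_law_with_norm ℝ (y - c) (z - c)
  have h4 : (1 / 2 : ℝ) • (y + z) - c = (1 / 2 : ℝ) • ((y - c) + (z - c)) := by module
  have h5 : y - c - (z - c) = y - z := by abel
  rw [hcd, dist_eq_norm, h4, norm_smul]
  rw [h5] at h3
  norm_num
  nlinarith

lemma growth (C : Set (EuclideanSpace ℝ (Fin n))) (hne : C.Nonempty) (hC : IsClosed C)
    (t : ℝ) (ht : t ∈ Icc (0 : ℝ) (1 / 2)) (x y : EuclideanSpace ℝ (Fin n)) (h : IsArg C t x y)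
    (z : EuclideanSpace ℝ (Fin n)) :
    t * infDist z C ^ 2 - ‖z - x‖ ^ 2 + ‖y - z‖ ^ 2 / 4 ≤
      t * infDist y C ^ 2 - ‖y - x‖ ^ 2 := by
  have h1 := h ((1 / 2 : ℝ) • (y + z))
  have h2 := mul_le_mul_of_nonneg_left (midpoint_ineq C hne hC y z) ht.1
  have h3 := parallelogram_law_with_norm ℝ (y - x) (z - x)
  have h4 : (1 / 2 : ℝ) • (y + z) - x = (1 / 2 : ℝ) • ((y - x) + (z - x)) := by module
  have h5 : y - x - (z - x) = y - z := by abel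
  rw [h4, norm_smul] at h1
  rw [h5] at h3
  rw [mul_pow, Real.norm_of_nonneg (by norm_num)] at h1
  have h6 : t * ‖y - z‖ ^ 2 ≤ 1 / 2 * ‖y - z‖ ^ 2 :=
    mul_le_mul_of_nonneg_right ht.2 (by positivity)
  nlinarith

lemma isArg_lip (C : Set (EuclideanSpace ℝ (Fin n))) (hne : C.Nonempty) (hC : IsClosed C)
    (t t' : ℝ) (ht : t ∈ Icc (0 : ℝ) (1 / 2)) (ht' : t' ∈ Icc (0 : ℝ) (1 / 2))
    (x y x' y' : EuclideanSpace ℝ (Fin n)) (h : IsArg C t x y) (h' : IsArg C t' x' y') :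
    ‖y - y'‖ ≤ 6 * |t - t'| * (infDist x C + infDist x' C) + 4 * ‖x - x'‖ := by
  have hb : ‖y - x‖ ≤ 2 * infDist x C := isArg_bound C t ht x y (by simpa using h x)
  have hb' : ‖y' - x'‖ ≤ 2 * infDist x' C := isArg_bound C t' ht' x' y' (by simpa using h' x')
  have hd := infDist_le_add C x y
  have hd' := infDist_le_add C x' y'
  have g1 := growth C hne hC t ht x y h y'
  have g2 := growth C hne hC t' ht' x' y' h' y
  rw [norm_sub_rev y' y] at g2
  have hid : ‖y' - x‖ ^ 2 - ‖y - x‖ ^ 2 + ‖y - x'‖ ^ 2 - ‖y' - x'‖ ^ 2 =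
      2 * inner ℝ (y - y') (x - x') := by
    simp only [norm_sub_sq_real, inner_sub_left, inner_sub_right]
    ring
  have hcs := real_inner_le_norm (y - y') (x - x')
  have e1 : |infDist y C - infDist y' C| ≤ ‖y - y'‖ := by
    rw [abs_le]
    have a1 := infDist_le_add C y y'
    have a2 := infDist_le_add C y' y
    rw [norm_sub_rev] at a1
    constructor <;> linarith
  have n1 : 0 ≤ infDist y C := infDist_nonneg
  have n2 : 0 ≤ infDist y' C := infDist_nonneg
  have e2 : (t - t') * (infDist y C ^ 2 - infDist y' C ^ 2) ≤
      |t - t'| * (‖y - y'‖ * (3 * (infDist x C + infDist x' C))) := by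
    refine (le_abs_self _).trans ?_
    rw [abs_mul]
    refine mul_le_mul_of_nonneg_left ?_ (abs_nonneg _)
    rw [sq_sub_sq, abs_mul, mul_comm, abs_of_nonneg (add_nonneg n1 n2)]
    exact mul_le_mul e1 (by linarith) (by positivity) (by positivity)
  have key : ‖y - y'‖ * ‖y - y'‖ ≤
      ‖y - y'‖ * (6 * |t - t'| * (infDist x C + infDist x' C) + 4 * ‖x - x'‖) := by
    nlinarith
  rcases (norm_nonneg (y - y')).eq_or_lt with h0 | h0
  · rw [← h0]
    have n1 : 0 ≤ infDist x C := infDist_nonneg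
    have n2 : 0 ≤ infDist x' C := infDist_nonneg
    positivity
  · exact le_of_mul_le_mul_left key h0

lemma grad_eq (C : Set (EuclideanSpace ℝ (Fin n)))
    (t : ℝ) (x y p : EuclideanSpace ℝ (Fin n)) (h : IsArg C t x y)
    (hp : p ∈ C) (hpd : infDist y C = ‖y - p‖)
    (hd : DifferentiableAt ℝ (fun z => infDist z C) y) : y - x = t • (y - p) := by
  have hd2 : DifferentiableAt ℝ (fun z => infDist z C ^ 2) y := hd.pow 2
  have hL := hd2.hasFDerivAt
  set L := fderiv ℝ (fun z => infDist z C ^ 2) y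
  have hn : ∀ q : EuclideanSpace ℝ (Fin n), HasFDerivAt (fun z => ‖z - q‖ ^ 2)
      (2 • (innerSL ℝ (y - q)).comp (ContinuousLinearMap.id ℝ _)) y := fun q =>
    ((hasFDerivAt_id y).sub_const q).norm_sq
  have e1 : IsLocalMin (fun z => ‖z - p‖ ^ 2 - infDist z C ^ 2) y := by
    refine Eventually.of_forall fun z => ?_
    have : infDist z C ^ 2 ≤ ‖z - p‖ ^ 2 := by
      rw [← dist_eq_norm]; exact pow_le_pow_left₀ infDist_nonneg (infDist_le_dist_of_mem hp) 2
    simp only [hpd]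
    linarith
  have e2 : IsLocalMax (fun z => t * infDist z C ^ 2 - ‖z - x‖ ^ 2) y :=
    Eventually.of_forall fun z => h z
  have f1 := e1.hasFDerivAt_eq_zero ((hn p).sub hL)
  have f2 := e2.hasFDerivAt_eq_zero ((hL.const_mul t).sub (hn x))
  refine ext_inner_right ℝ fun v => ?_
  have f1v := DFunLike.congr_fun f1 v
  have f2v := DFunLike.congr_fun f2 v
  simp at f1v f2v
  rw [inner_smul_left]
  simp
  have : L v = 2 * inner ℝ (y - p) v := by
    simp only [inner_sub_left]; linarith
  rw [this] at f2v
  simp only [inner_sub_left] at f2v ⊢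
  linarith

lemma sandwich {E : Type*} [NormedAddCommGroup E] [NormedSpace ℝ E] (f d g : E → ℝ) (x : E)
    (hf : DifferentiableAt ℝ f x) (hg : DifferentiableAt ℝ g x)
    (h1 : ∀ z, f z ≤ d z) (h2 : ∀ z, d z ≤ g z) (hfx : f x = d x) (hgx : g x = d x) :
    DifferentiableAt ℝ d x := by
  have e : IsLocalMin (fun z => g z - f z) x := by
    refine Eventually.of_forall fun z => ?_
    have := h1 z
    have := h2 z
    simp only [hfx, hgx]
    linarith
  have f1 := e.hasFDerivAt_eq_zero (hg.hasFDerivAt.sub hf.hasFDerivAt)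
  have hg' := hg.hasFDerivAt
  rw [sub_eq_zero.1 f1] at hg'
  refine HasFDerivAt.differentiableAt (f' := fderiv ℝ f x) ?_
  have a := hf.hasFDerivAt.isLittleO
  have b := hg'.isLittleO
  refine HasFDerivAt.of_isLittleO ?_
  rw [Asymptotics.isLittleO_iff] at a b ⊢
  intro c hc
  filter_upwards [a hc, b hc] with z hz1 hz2
  rw [Real.norm_eq_abs, abs_le] at hz1 hz2 ⊢
  have := h1 z
  have := h2 z
  constructor <;> linarith [hz1.1, hz2.2]

lemma diff_back (C : Set (EuclideanSpace ℝ (Fin n))) (hne : C.Nonempty) (hC : IsClosed C)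
    (t : ℝ) (ht : t ∈ Icc (0 : ℝ) (1 / 2)) (x y : EuclideanSpace ℝ (Fin n)) (h : IsArg C t x y)
    (hy : y ∉ C)
    (hd : DifferentiableAt ℝ (fun z => infDist z C) y) :
    DifferentiableAt ℝ (fun z => infDist z C) x := by
  obtain ⟨p, hp, hpd⟩ := hC.exists_infDist_eq_dist hne y
  rw [dist_eq_norm] at hpd
  have hg := grad_eq C t x y p h hp hpd hd
  obtain ⟨ht0, ht1⟩ := ht
  have hyp : y - p ≠ 0 := by
    intro h0; rw [sub_eq_zero] at h0; exact hy (h0 ▸ hp)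
  rcases ht0.eq_or_lt with h0 | h0
  · rw [← h0, zero_smul, sub_eq_zero] at hg
    rwa [← hg]
  have hxp : x - p = (1 - t) • (y - p) := by
    rw [sub_smul, one_smul, ← hg]; abel
  have hxp0 : x - p ≠ 0 := by
    rw [hxp]; exact smul_ne_zero (by linarith) hyp
  have hyx0 : y - x ≠ 0 := by
    rw [hg]; exact smul_ne_zero h0.ne' hyp
  have n1 : ‖x - p‖ = (1 - t) * ‖y - p‖ := by
    rw [hxp, norm_smul, Real.norm_of_nonneg (by linarith)]
  have n2 : ‖y - x‖ = t * ‖y - p‖ := by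
    rw [hg, norm_smul, Real.norm_of_nonneg (by linarith)]
  have l1 : ∀ z, infDist y C - ‖y - z‖ ≤ infDist z C := fun z => by
    have := infDist_le_add C z y; linarith
  have l2 : ∀ z, infDist z C ≤ ‖z - p‖ := fun z => by
    rw [← dist_eq_norm]; exact infDist_le_dist_of_mem hp
  have l1x := l1 x
  have l2x := l2 x
  refine sandwich (fun z => infDist y C - ‖y - z‖) _ (fun z => ‖z - p‖) x ?_ ?_ l1 l2 ?_ ?_
  · exact (differentiableAt_const _).sub
      (((differentiableAt_const _).sub differentiableAt_id).norm ℝ hyx0)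
  · exact (differentiableAt_id.sub (differentiableAt_const _)).norm ℝ hxp0
  · nlinarith
  · nlinarith

lemma double (C : Set (EuclideanSpace ℝ (Fin n))) (hne : C.Nonempty) (hC : IsClosed C)
    (x y : EuclideanSpace ℝ (Fin n)) (h : IsArg C (1 / 2) x y)
    (hd : DifferentiableAt ℝ (fun z => infDist z C) y) :
    2 * infDist x C ≤ infDist y C := by
  obtain ⟨p, hp, hpd⟩ := hC.exists_infDist_eq_dist hne y
  rw [dist_eq_norm] at hpd
  have hg := grad_eq C _ x y p h hp hpd hd
  have hxp : x - p = (1 / 2 : ℝ) • (y - p) := by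
    have : x - p = (y - p) - (y - x) := by abel
    rw [this, hg]; module
  have : infDist x C ≤ ‖x - p‖ := by
    rw [← dist_eq_norm]; exact infDist_le_dist_of_mem hp
  rw [hxp, norm_smul] at this
  norm_num at this
  linarith

end

theorem sigma_star_inter_boundedComponent_homotopyEquiv (n : ℕ)
    (C U : Set (EuclideanSpace ℝ (Fin n))) (hne : C.Nonempty) (hC : IsClosed C)
    (hU : ∃ x ∈ Cᶜ, U = connectedComponentIn Cᶜ x)
    (hUb : Bornology.IsBounded U) :
    InclusionIsHomotopyEquiv
      {y : U | (y : EuclideanSpace ℝ (Fin n)) ∉ C ∧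
        ¬ DifferentiableAt ℝ (fun z => Metric.infDist z C)
          (y : EuclideanSpace ℝ (Fin n))} := by
  obtain ⟨x₀, hx₀, hUeq⟩ := hU
  have hUC : ∀ x ∈ U, x ∉ C := fun x hx => by
    rw [hUeq] at hx; exact connectedComponentIn_subset _ _ hx
  -- clamp
  let c : ℝ → ℝ := fun t => max 0 (min t 1) / 2
  have hcc : Continuous c := by fun_prop
  have hcm : ∀ t, c t ∈ Icc (0 : ℝ) (1 / 2) := fun t => by
    have h1 : max 0 (min t 1) ≤ (1 : ℝ) := max_le (by norm_num) (min_le_right _ _)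
    have h2 : (0 : ℝ) ≤ max 0 (min t 1) := le_max_left _ _
    constructor <;> simp only [c] <;> linarith
  have hc0 : ∀ t ≤ 0, c t = 0 := fun t ht => by
    have : min t 1 ≤ 0 := (min_le_left _ _).trans ht
    simp [c, max_eq_left this]
  have hc1 : ∀ t, 1 ≤ t → c t = 1 / 2 := fun t ht => by
    simp [c, min_eq_right ht]
  choose G hG using fun (t : ℝ) (x : EuclideanSpace ℝ (Fin n)) => exists_isArg C (c t) (hcm t) x
  have hGcont : Continuous (fun p : ℝ × EuclideanSpace ℝ (Fin n) => G p.1 p.2) := by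
    rw [continuous_iff_continuousAt]
    intro p
    rw [ContinuousAt, tendsto_iff_norm_sub_tendsto_zero]
    have hid := continuous_infDist_pt C
    have hlim : Tendsto (fun q : ℝ × EuclideanSpace ℝ (Fin n) =>
        6 * |c q.1 - c p.1| * (infDist q.2 C + infDist p.2 C) + 4 * ‖q.2 - p.2‖) (𝓝 p) (𝓝 0) := by
      have : Continuous (fun q : ℝ × EuclideanSpace ℝ (Fin n) =>
        6 * |c q.1 - c p.1| * (infDist q.2 C + infDist p.2 C) + 4 * ‖q.2 - p.2‖) := by fun_prop
      have h := this.tendsto p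
      simpa using h
    refine squeeze_zero (fun _ => norm_nonneg _) (fun q => ?_) hlim
    exact isArg_lip C hne hC _ _ (hcm _) (hcm _) _ _ _ _ (hG q.1 q.2) (hG p.1 p.2)
  have hG0 : ∀ t ≤ 0, ∀ x, G t x = x := fun t ht x => by
    have h := hG t x x
    rw [hc0 t ht] at h
    simp only [zero_mul, sub_self, norm_zero] at h
    have h3 : ‖G t x - x‖ ^ 2 ≤ 0 := by nlinarith
    have : ‖G t x - x‖ = 0 := by nlinarith [norm_nonneg (G t x - x)]
    exact sub_eq_zero.1 (norm_eq_zero.1 this)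
  have hG1 : ∀ t, 1 ≤ t → ∀ x, G t x = G 1 x := fun t ht x => by
    have h := isArg_lip C hne hC _ _ (hcm t) (hcm 1) _ _ _ _ (hG t x) (hG 1 x)
    rw [hc1 t ht, hc1 1 le_rfl] at h
    simp only [sub_self, abs_zero, mul_zero, zero_mul, norm_zero, add_zero] at h
    exact sub_eq_zero.1 (norm_eq_zero.1 (le_antisymm h (norm_nonneg _)))
  have hpos : ∀ x, x ∉ C → 0 < infDist x C := fun x hx =>
    (hC.notMem_iff_infDist_pos hne).1 hx
  have hGC : ∀ t x, x ∉ C → G t x ∉ C := fun t x hx hcon => by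
    have h := hG t x x
    rw [infDist_zero_of_mem hcon] at h
    have hx' := hpos x hx
    have hb := (hcm t).1
    simp only [sub_self, norm_zero] at h
    have h3 : ‖G t x - x‖ ^ 2 ≤ 0 := by nlinarith [mul_nonneg hb (sq_nonneg (infDist x C))]
    have : ‖G t x - x‖ = 0 := by nlinarith [norm_nonneg (G t x - x)]
    rw [sub_eq_zero.1 (norm_eq_zero.1 this)] at hcon
    exact hx hcon
  have hGU : ∀ t, ∀ x ∈ U, G t x ∈ U := fun t x hx => by
    have hxC := hUC x hx
    have hUx : U = connectedComponentIn Cᶜ x := by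
      rw [hUeq] at hx ⊢
      exact connectedComponentIn_eq hx
    have hpre : IsPreconnected (range fun s => G s x) :=
      isPreconnected_range (hGcont.comp (by fun_prop : Continuous fun s : ℝ => (s, x)))
    rw [hUx]
    refine hpre.subset_connectedComponentIn ⟨0, hG0 0 le_rfl x⟩ ?_ ⟨t, rfl⟩
    rintro _ ⟨s, rfl⟩
    exact hGC s x hxC
  obtain ⟨D, hD⟩ : ∃ D : ℝ, ∀ x ∈ U, infDist x C ≤ D := by
    obtain ⟨R, hR⟩ := hUb.subset_closedBall (0 : EuclideanSpace ℝ (Fin n))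
    refine ⟨infDist 0 C + R, fun x hx => ?_⟩
    have h1 := infDist_le_add C 0 x
    have h2 := hR hx
    rw [mem_closedBall, dist_eq_norm] at h2
    linarith
  let F : ℝ → U → U := fun t x => ⟨G t x, hGU t x x.2⟩
  refine inclusion_of_flow _ F ?_ ?_ ?_ ?_ (fun x => D / infDist (x : EuclideanSpace ℝ (Fin n)) C + 1) ?_ ?_
  · refine Continuous.subtype_mk ?_ _
    exact hGcont.comp (by fun_prop : Continuous fun p : ℝ × U => (p.1, (p.2 : EuclideanSpace ℝ (Fin n))))
  · intro t ht x
    exact Subtype.ext (hG0 t ht x)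
  · intro t ht x
    exact Subtype.ext (hG1 t ht x)
  · rintro t x ⟨hx1, hx2⟩
    refine ⟨hGC t x hx1, fun hd => hx2 ?_⟩
    exact diff_back C hne hC (c t) (hcm t) x (G t x) (hG t x) (hGC t x hx1) hd
  · refine Continuous.add (Continuous.div continuous_const ?_ ?_) continuous_const
    · exact (continuous_infDist_pt C).comp continuous_subtype_val
    · intro x; exact (hpos x (hUC x x.2)).ne'
  · intro x
    have hx := hpos x (hUC x x.2)
    have hD0 : 0 ≤ D := hx.le.trans (hD x x.2)
    refine ⟨⌊D / infDist (x : EuclideanSpace ℝ (Fin n)) C + 1⌋₊, Nat.floor_le (by positivity), ?_⟩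
    set k := ⌊D / infDist (x : EuclideanSpace ℝ (Fin n)) C + 1⌋₊ with hk
    by_contra hcon
    have hiter : ∀ j : ℕ, (F 1)^[j] x ∉ {y : U | (y : EuclideanSpace ℝ (Fin n)) ∉ C ∧
        ¬ DifferentiableAt ℝ (fun z => Metric.infDist z C) (y : EuclideanSpace ℝ (Fin n))} →
        2 ^ j * infDist (x : EuclideanSpace ℝ (Fin n)) C ≤
          infDist (((F 1)^[j] x : U) : EuclideanSpace ℝ (Fin n)) C := by
      intro j
      induction j with
      | zero => intro _; simp
      | succ j ih =>
        intro hj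
        rw [Function.iterate_succ_apply'] at hj ⊢
        set w := (F 1)^[j] x
        have hwC := hUC w w.2
        have hdy : DifferentiableAt ℝ (fun z => infDist z C) (G 1 w) := by
          by_contra hnd
          exact hj ⟨hGC 1 w hwC, hnd⟩
        have hw := hG 1 w
        have hdw := diff_back C hne hC _ (hcm 1) w (G 1 w) hw (hGC 1 w hwC) hdy
        rw [hc1 1 le_rfl] at hw
        have h2 := double C hne hC w (G 1 w) hw hdy
        have h3 := ih (fun hm => hm.2 hdw)
        change _ ≤ infDist (G 1 w) C
        rw [pow_succ]
        linarith
    have h1 := hiter k hcon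
    have h2 := hD _ ((F 1)^[k] x).2
    have h3 : D / infDist (x : EuclideanSpace ℝ (Fin n)) C + 1 < k + 1 := Nat.lt_floor_add_one _
    have h4 : (k : ℝ) < 2 ^ k := by exact_mod_cast Nat.lt_two_pow_self
    have h5 : D / infDist (x : EuclideanSpace ℝ (Fin n)) C < 2 ^ k := by linarith
    rw [div_lt_iff₀ hx] at h5
    linarith
end

section
/- Let E be a real normed vector space, let u : E → ℝ be bounded below, and let s, t > 0. Then for all x, y ∈ E, ( ⨅_{z ∈ E} ( u(z) + ‖y − z‖²/(2(s+t)) ) ) − ‖x − y‖²/(2s) ≤ ⨅_{z ∈ E} ( u(z) + ‖x − z‖²/(2t) ). Equivalently, T⁺_s T⁻_{s+t} u ≤ T⁻_t u pointwise. -/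
open Metric Set

/-- Pointwise inequality `T⁺_s T⁻_{s+t} u ≤ T⁻_t u` for the Lax–Oleinik operators of the
quadratic Hamiltonian: for `u` bounded below and `s, t > 0`,
`( inf_z ( u z + ‖y - z‖²/(2(s+t)) ) ) - ‖x - y‖²/(2s) ≤ inf_z ( u z + ‖x - z‖²/(2t) )`. -/
theorem laxOleinik_plus_minus_le {E : Type*} [NormedAddCommGroup E] [NormedSpace ℝ E]
    (u : E → ℝ) (hb : BddBelow (Set.range u)) (s t : ℝ) (hs : 0 < s) (ht : 0 < t)
    (x y : E) :
    (⨅ z : E, (u z + ‖y - z‖ ^ 2 / (2 * (s + t)))) - ‖x - y‖ ^ 2 / (2 * s)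
      ≤ ⨅ z : E, (u z + ‖x - z‖ ^ 2 / (2 * t)) := by
  obtain ⟨m, hm⟩ := hb
  apply le_ciInf
  intro z
  have h1 : (⨅ z : E, (u z + ‖y - z‖ ^ 2 / (2 * (s + t)))) ≤ u z + ‖y - z‖ ^ 2 / (2 * (s + t)) := by
    refine ciInf_le (f := fun z : E => u z + ‖y - z‖ ^ 2 / (2 * (s + t))) ⟨m, ?_⟩ z
    rintro _ ⟨w, rfl⟩
    have h2 : m ≤ u w := hm ⟨w, rfl⟩
    have h3 : 0 ≤ ‖y - w‖ ^ 2 / (2 * (s + t)) := by positivity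
    show m ≤ u w + ‖y - w‖ ^ 2 / (2 * (s + t))
    linarith
  have h4 : ‖y - z‖ ≤ ‖x - y‖ + ‖x - z‖ := by
    have := norm_sub_le_norm_sub_add_norm_sub y x z
    rwa [norm_sub_rev y x] at this
  have h5 : ‖y - z‖ ^ 2 / (2 * (s + t)) ≤ (‖x - y‖ + ‖x - z‖) ^ 2 / (2 * (s + t)) := by
    gcongr
  have h6 : (‖x - y‖ + ‖x - z‖) ^ 2 / (2 * (s + t))
      ≤ ‖x - y‖ ^ 2 / (2 * s) + ‖x - z‖ ^ 2 / (2 * t) := by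
    generalize ‖x - y‖ = a
    generalize ‖x - z‖ = b
    have h7 : a ^ 2 / (2 * s) + b ^ 2 / (2 * t) - (a + b) ^ 2 / (2 * (s + t))
        = (a * t - b * s) ^ 2 / (2 * s * t * (s + t)) := by
      field_simp
      ring
    have h8 : 0 ≤ (a * t - b * s) ^ 2 / (2 * s * t * (s + t)) := by positivity
    linarith
  linarith
end

section
/- Let X be a metric space, C a nonempty subset of X, t, s > 0, and x, y ∈ X. Write d_C(z) = infDist(z, C). If d_C(x)²/(2(t+s)) − dist(y,x)²/(2s) ≥ d_C(y)²/(2(t+s)), then dist(x,y) ≤ (2s/t)·d_C(y) and d_C(x) ≤ (1 + 2s/t)·d_C(y). -/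
open Metric Set

/-- Lemma 7.1 of the paper: if `φ_{t,s,y}(x) ≥ φ_{t,s,y}(y)` where
`φ_{t,s,y}(x) = d_C(x)²/(2(t+s)) - dist(y,x)²/(2s)`, then
`dist(x,y) ≤ (2s/t)·d_C(y)` and `d_C(x) ≤ (1 + 2s/t)·d_C(y)`. -/
theorem dist_le_of_phi_ge {X : Type*} [MetricSpace X] (C : Set X) (hne : C.Nonempty)
    (t s : ℝ) (ht : 0 < t) (hs : 0 < s) (x y : X)
    (h : Metric.infDist y C ^ 2 / (2 * (t + s))
        ≤ Metric.infDist x C ^ 2 / (2 * (t + s)) - dist y x ^ 2 / (2 * s)) :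
    dist x y ≤ (2 * s / t) * Metric.infDist y C ∧
    Metric.infDist x C ≤ (1 + 2 * s / t) * Metric.infDist y C := by
  have hb : Metric.infDist x C ≤ Metric.infDist y C + dist x y :=
    Metric.infDist_le_infDist_add_dist
  have ha0 : 0 ≤ Metric.infDist y C := Metric.infDist_nonneg
  have hb0 : 0 ≤ Metric.infDist x C := Metric.infDist_nonneg
  have hd0 : 0 ≤ dist x y := dist_nonneg
  rw [dist_comm y x] at h
  generalize Metric.infDist x C = b at *
  generalize Metric.infDist y C = a at *
  generalize dist x y = d at *
  have h1 : d ^ 2 / (2 * s) ≤ (b ^ 2 - a ^ 2) / (2 * (t + s)) := by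
    rw [sub_div]; linarith
  rw [div_le_div_iff₀ (by positivity) (by positivity)] at h1
  have hsq : b ^ 2 ≤ (a + d) ^ 2 := pow_le_pow_left₀ hb0 hb 2
  have h2 : d * (t * d) ≤ d * (2 * s * a) := by
    have := mul_le_mul_of_nonneg_left hsq hs.le
    nlinarith
  have key : d ≤ (2 * s / t) * a := by
    rw [div_mul_eq_mul_div, le_div_iff₀ ht]
    rcases hd0.eq_or_lt with h0 | h0
    · rw [← h0, zero_mul]; positivity
    · linarith [le_of_mul_le_mul_left h2 h0]
  exact ⟨key, by linarith⟩
end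

section
/- Let X be a metric space, C a nonempty subset of X, and write d_C(z) = infDist(z, C). Let t₀ > 0, and let (tₙ) and (xₙ) be sequences with tₙ₊₁ = tₙ + sₙ where sₙ > 0 for all n, and suppose that for every n: d_C(xₙ₊₁)²/(2·tₙ₊₁) − dist(xₙ, xₙ₊₁)²/(2·sₙ) ≥ d_C(xₙ)²/(2·tₙ₊₁). Then for every n: d_C(xₙ) ≤ exp(2·tₙ/t₀)·d_C(x₀) and dist(xₙ, x₀) ≤ 2·exp(3·tₙ/t₀)·d_C(x₀). -/
open Metric Set

/-- Lemma 7.2 of the paper: along a sequence `(tₙ, xₙ)` with `tₙ₊₁ = tₙ + sₙ`, `sₙ > 0`,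
satisfying `φ_{tₙ,sₙ,xₙ}(xₙ₊₁) ≥ φ_{tₙ,sₙ,xₙ}(xₙ)`, one has
`d_C(xₙ) ≤ exp(2 tₙ/t₀) d_C(x₀)` and `dist(xₙ, x₀) ≤ 2 exp(3 tₙ/t₀) d_C(x₀)`. -/
theorem dist_bounds_along_sequence {X : Type*} [MetricSpace X] (C : Set X) (hne : C.Nonempty)
    (t s : ℕ → ℝ) (x : ℕ → X) (ht0 : 0 < t 0) (hspos : ∀ n, 0 < s n)
    (htrec : ∀ n, t (n + 1) = t n + s n)
    (hphi : ∀ n, Metric.infDist (x n) C ^ 2 / (2 * t (n + 1))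
        ≤ Metric.infDist (x (n + 1)) C ^ 2 / (2 * t (n + 1))
          - dist (x n) (x (n + 1)) ^ 2 / (2 * s n)) :
    ∀ n, Metric.infDist (x n) C ≤ Real.exp (2 * t n / t 0) * Metric.infDist (x 0) C ∧
      dist (x n) (x 0) ≤ 2 * Real.exp (3 * t n / t 0) * Metric.infDist (x 0) C := by
  have htn : ∀ n, t 0 ≤ t n := by
    intro n
    induction n with
    | zero => exact le_rfl
    | succ k ih => rw [htrec]; linarith [hspos k]
  have step : ∀ n, dist (x n) (x (n + 1)) ≤ 2 * (s n / t 0) * Metric.infDist (x n) C ∧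
      Metric.infDist (x (n + 1)) C ≤ (1 + 2 * (s n / t 0)) * Metric.infDist (x n) C := by
    intro n
    have hs := hspos n
    have ht : 0 < t n := lt_of_lt_of_le ht0 (htn n)
    have hT : 0 < t (n + 1) := lt_of_lt_of_le ht0 (htn _)
    have hb : Metric.infDist (x (n + 1)) C ≤ Metric.infDist (x n) C + dist (x n) (x (n + 1)) := by
      rw [dist_comm]; exact Metric.infDist_le_infDist_add_dist
    have h := hphi n
    have ha0 : 0 ≤ Metric.infDist (x n) C := Metric.infDist_nonneg
    have hb0 : 0 ≤ Metric.infDist (x (n + 1)) C := Metric.infDist_nonneg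
    have hd0 : 0 ≤ dist (x n) (x (n + 1)) := dist_nonneg
    have hTe := htrec n
    generalize Metric.infDist (x n) C = a at *
    generalize Metric.infDist (x (n + 1)) C = b at *
    generalize dist (x n) (x (n + 1)) = d at *
    have h1 : d ^ 2 * t (n + 1) ≤ s n * (b ^ 2 - a ^ 2) := by
      have h2 : d ^ 2 / (2 * s n) ≤ (b ^ 2 - a ^ 2) / (2 * t (n + 1)) := by
        rw [sub_div]; linarith
      rw [div_le_div_iff₀ (by positivity) (by positivity)] at h2
      linarith
    have h3 : d * t (n + 1) ≤ s n * (a + b) := by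
      rcases hd0.eq_or_lt with h0 | h0
      · rw [← h0, zero_mul]; positivity
      · have h4 : (b - a) * (s n * (a + b)) ≤ d * (s n * (a + b)) :=
          mul_le_mul_of_nonneg_right (by linarith) (by positivity)
        have h5 : d * (d * t (n + 1)) ≤ d * (s n * (a + b)) := by nlinarith
        exact le_of_mul_le_mul_left h5 h0
    have h6 : d * t n ≤ 2 * s n * a := by
      rw [hTe] at h3
      have := mul_le_mul_of_nonneg_left hb hs.le
      nlinarith
    have h7 : d ≤ 2 * (s n / t 0) * a := by
      have h8 : d * t 0 ≤ 2 * s n * a :=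
        (mul_le_mul_of_nonneg_left (htn n) hd0).trans h6
      calc d ≤ 2 * s n * a / t 0 := (le_div_iff₀ ht0).2 h8
        _ = _ := by ring
    exact ⟨h7, by linarith⟩
  intro n
  have hD : 0 ≤ Metric.infDist (x 0) C := Metric.infDist_nonneg
  induction n with
  | zero =>
    constructor
    · exact le_mul_of_one_le_left hD (Real.one_le_exp (by positivity))
    · rw [dist_self]; positivity
  | succ k ih =>
    obtain ⟨i1, i2⟩ := ih
    obtain ⟨s1, s2⟩ := step k
    have hσ : 0 ≤ s k / t 0 := div_nonneg (hspos k).le ht0.le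
    have hu : 0 ≤ t k / t 0 := div_nonneg (ht0.le.trans (htn k)) ht0.le
    have e2 : 2 * t (k + 1) / t 0 = 2 * (s k / t 0) + 2 * t k / t 0 := by rw [htrec]; ring
    have e3 : 3 * t (k + 1) / t 0 = 3 * (s k / t 0) + 3 * t k / t 0 := by rw [htrec]; ring
    have e23 : Real.exp (2 * t k / t 0) ≤ Real.exp (3 * t k / t 0) := by
      apply Real.exp_le_exp.2
      rw [mul_div_assoc, mul_div_assoc]; linarith
    rw [e2, e3, Real.exp_add, Real.exp_add]
    generalize s k / t 0 = σ at *
    have x2 := Real.add_one_le_exp (2 * σ)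
    have x3 := Real.add_one_le_exp (3 * σ)
    constructor
    · calc _ ≤ _ := s2
        _ ≤ Real.exp (2 * σ) * (Real.exp (2 * t k / t 0) * Metric.infDist (x 0) C) :=
          mul_le_mul (by linarith) i1 Metric.infDist_nonneg (Real.exp_pos _).le
        _ = _ := by ring
    · have tri := dist_triangle (x (k + 1)) (x k) (x 0)
      rw [dist_comm (x (k + 1)) (x k)] at tri
      have j1 : Metric.infDist (x k) C ≤ Real.exp (3 * t k / t 0) * Metric.infDist (x 0) C :=
        i1.trans (mul_le_mul_of_nonneg_right e23 hD)
      have j2 := mul_le_mul_of_nonneg_left j1 (by positivity : 0 ≤ 2 * σ)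
      have hP : 0 ≤ Real.exp (3 * t k / t 0) * Metric.infDist (x 0) C := by positivity
      have j3 : (1 + σ) * (Real.exp (3 * t k / t 0) * Metric.infDist (x 0) C) ≤
          Real.exp (3 * σ) * (Real.exp (3 * t k / t 0) * Metric.infDist (x 0) C) :=
        mul_le_mul_of_nonneg_right (by linarith) hP
      linarith
end

section
/- Let X be a metric space, C a nonempty closed subset of X, and let U be a connected component of X \ C that is bounded. Suppose γ : [0,∞) → X satisfies dist(γ(s), γ(t)) = |s − t| for all s, t ≥ 0 and infDist(γ(t), C) = t for all t ≥ 0. Then γ(t₀) ∉ U for every t₀ > 0. -/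
open Metric Set

/-- A bounded connected component of the complement of a nonempty closed set `C` contains no
point of a unit-speed geodesic ray calibrated by the distance function to `C`. -/
theorem calibrated_ray_avoids_bounded_component {X : Type*} [MetricSpace X]
    (C : Set X) (hne : C.Nonempty) (hC : IsClosed C)
    (U : Set X) (hU : ∃ x ∈ Cᶜ, U = connectedComponentIn Cᶜ x)
    (hUb : Bornology.IsBounded U)
    (γ : ℝ → X)
    (hgeo : ∀ s t : ℝ, 0 ≤ s → 0 ≤ t → dist (γ s) (γ t) = |s - t|)
    (hcal : ∀ t : ℝ, 0 ≤ t → Metric.infDist (γ t) C = t)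
    (t₀ : ℝ) (ht₀ : 0 < t₀) :
    γ t₀ ∉ U := by
  intro hmem
  obtain ⟨x, hx, rfl⟩ := hU
  have hcont : ContinuousOn γ (Ici t₀) := by
    have hl : LipschitzOnWith 1 γ (Ici t₀) := by
      apply LipschitzOnWith.of_dist_le_mul
      intro a ha b hb
      rw [hgeo a b (ht₀.le.trans ha) (ht₀.le.trans hb), Real.dist_eq]
      simp
    exact hl.continuousOn
  have hpre : IsPreconnected (γ '' Ici t₀) := isPreconnected_Ici.image γ hcont
  have hsub : γ '' Ici t₀ ⊆ Cᶜ := by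
    rintro _ ⟨t, ht, rfl⟩ hc
    have ht' : t₀ ≤ t := ht
    have h1 := hcal t (ht₀.le.trans ht')
    rw [Metric.infDist_zero_of_mem hc] at h1
    linarith
  have hin : γ '' Ici t₀ ⊆ connectedComponentIn Cᶜ x := by
    rw [connectedComponentIn_eq hmem]
    exact hpre.subset_connectedComponentIn ⟨t₀, self_mem_Ici, rfl⟩ hsub
  obtain ⟨R, hR⟩ := Metric.isBounded_iff.1 hUb
  have hR0 : 0 ≤ R := dist_nonneg.trans (hR hmem hmem)
  have h2 : t₀ ≤ t₀ + R + 1 := by linarith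
  have h := hR (hin ⟨t₀ + R + 1, h2, rfl⟩) hmem
  rw [hgeo _ _ (by linarith) ht₀.le, abs_of_nonneg (by linarith)] at h
  linarith
end

section
/- Let n be a natural number and u : ℝⁿ → ℝ a function bounded below. Define û(t,x) = ⨅_{y ∈ ℝⁿ} ( u(y) + ‖x − y‖²/(2t) ) for t > 0 and x ∈ ℝⁿ. Then the set Σ(û) of points (t,x) ∈ (0,∞) × ℝⁿ at which the function (t,x) ↦ û(t,x) is not Fréchet differentiable is locally contractible (with the subspace topology induced from ℝ × ℝⁿ). -/
set_option linter.unusedSectionVars false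

open Metric Set

/-- The negative Lax–Oleinik (Hopf–Lax) evolution of `u` for the quadratic Hamiltonian,
viewed as a function on `ℝ × ℝⁿ` (its values for `t ≤ 0` are irrelevant on `(0,∞) × ℝⁿ`). -/
noncomputable def hopfLax (n : ℕ) (u : EuclideanSpace ℝ (Fin n) → ℝ)
    (p : ℝ × EuclideanSpace ℝ (Fin n)) : ℝ :=
  ⨅ y : EuclideanSpace ℝ (Fin n), (u y + ‖p.2 - y‖ ^ 2 / (2 * p.1))

open Filter Topology

namespace HLax

section
variable {E : Type*} [NormedAddCommGroup E] [InnerProductSpace ℝ E] [FiniteDimensional ℝ E]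

/-- the affine function with slope `(-‖y‖²/2, y)` -/
noncomputable def aff (y : E) (z : ℝ × E) : ℝ := inner ℝ z.2 y - z.1 * ‖y‖ ^ 2 / 2

noncomputable def G (u : E → ℝ) (z : ℝ × E) : ℝ := ⨆ y : E, (aff y z - u y)

lemma aff_bound (y : E) (z : ℝ × E) (hz : 0 < z.1) : aff y z ≤ ‖z.2‖ ^ 2 / (2 * z.1) := by
  unfold aff
  have h1 := real_inner_le_norm z.2 y
  rw [le_div_iff₀ (by positivity)]
  nlinarith [sq_nonneg (‖z.2‖ - z.1 * ‖y‖)]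

lemma bdd (u : E → ℝ) (hb : BddBelow (Set.range u)) (z : ℝ × E) (hz : 0 < z.1) :
    BddAbove (Set.range fun y : E => aff y z - u y) := by
  obtain ⟨c, hc⟩ := hb
  refine ⟨‖z.2‖ ^ 2 / (2 * z.1) - c, ?_⟩
  rintro _ ⟨y, rfl⟩
  have := hc ⟨y, rfl⟩
  have := aff_bound y z hz
  simp only
  linarith

lemma G_ge (u : E → ℝ) (hb : BddBelow (Set.range u)) (z : ℝ × E) (hz : 0 < z.1) (y : E) :
    aff y z - u y ≤ G u z := le_ciSup (bdd u hb z hz) y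

lemma G_le (u : E → ℝ) (z : ℝ × E) (c : ℝ) (h : ∀ y, aff y z - u y ≤ c) : G u z ≤ c :=
  ciSup_le h

lemma G_convex (u : E → ℝ) (hb : BddBelow (Set.range u)) :
    ConvexOn ℝ {z : ℝ × E | 0 < z.1} (G u) := by
  refine ⟨?_, ?_⟩
  · exact convex_halfSpace_gt (f := fun z : ℝ × E => z.1) ⟨fun _ _ => rfl, fun _ _ => rfl⟩ 0
  · intro x hx y hy a b ha hb' hab
    apply G_le
    intro w
    have h1 := mul_le_mul_of_nonneg_left (G_ge u hb x hx w) ha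
    have h2 := mul_le_mul_of_nonneg_left (G_ge u hb y hy w) hb'
    have h3 : aff w (a • x + b • y) = a * aff w x + b * aff w y := by
      simp [aff, inner_add_left, real_inner_smul_left]; ring
    simp only [smul_eq_mul]
    rw [h3]
    have : u w = a * u w + b * u w := by rw [← add_mul, hab, one_mul]
    linarith

lemma G_cont (u : E → ℝ) (hb : BddBelow (Set.range u)) :
    ContinuousOn (G u) {z : ℝ × E | 0 < z.1} :=
  (G_convex u hb).continuousOn (isOpen_lt continuous_const continuous_fst)

lemma G_contAt (u : E → ℝ) (hb : BddBelow (Set.range u)) (z : ℝ × E) (hz : 0 < z.1) :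
    ContinuousAt (G u) z :=
  (G_cont u hb).continuousAt ((isOpen_lt continuous_const continuous_fst).mem_nhds hz)

lemma aff_sub (y : E) (z w : ℝ × E) : aff y (z - w) = aff y z - aff y w := by
  simp [aff, inner_sub_left]; ring

/-- Hopf-Lax inequality -/
lemma G_HL (u : E → ℝ) (hb : BddBelow (Set.range u)) (z w : ℝ × E) (hz : 0 < z.1)
    (hw : z.1 < w.1) : G u w ≤ G u z + ‖w.2 - z.2‖ ^ 2 / (2 * (w.1 - z.1)) := by
  apply G_le
  intro y
  have h1 := G_ge u hb z hz y
  have h2 := aff_bound y (w - z) (by simpa using hw)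
  rw [aff_sub] at h2
  simp only [Prod.fst_sub, Prod.snd_sub] at h2
  linarith

/-- `y` is a minimizer direction at `z` -/
def Cal (u : E → ℝ) (z : ℝ × E) (y : E) : Prop :=
  ∀ w : ℝ × E, 0 < w.1 → G u z + aff y (w - z) ≤ G u w

lemma exists_cal (u : E → ℝ) (hb : BddBelow (Set.range u)) (z : ℝ × E) (hz : 0 < z.1) :
    ∃ y, Cal u z y := by
  have h : ∀ k : ℕ, ∃ y : E, G u z - 1 / ((k : ℝ) + 1) < aff y z - u y := by
    intro k
    apply exists_lt_of_lt_ciSup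
    have : (0 : ℝ) < 1 / ((k : ℝ) + 1) := by positivity
    change _ < G u z
    linarith
  choose y hy using h
  obtain ⟨c, hc⟩ := hb
  have hbd : ∀ k, y k ∈ Metric.closedBall (0 : E)
      (1 + 4 * (‖z.2‖ ^ 2 / z.1 + |1 - c - G u z|) / z.1) := by
    intro k
    rw [mem_closedBall_zero_iff]
    have h1 := hy k
    have h2 : c ≤ u (y k) := hc ⟨_, rfl⟩
    have h3 : 1 / ((k : ℝ) + 1) ≤ 1 := by
      rw [div_le_one (by positivity)]; linarith [(Nat.cast_nonneg k : (0 : ℝ) ≤ k)]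
    have h4 := le_abs_self (1 - c - G u z)
    have h5 := real_inner_le_norm z.2 (y k)
    unfold aff at h1
    have h6 : ‖z.2‖ * ‖y k‖ ≤ z.1 * ‖y k‖ ^ 2 / 4 + ‖z.2‖ ^ 2 / z.1 := by
      have : z.1 * ‖y k‖ ^ 2 / 4 + ‖z.2‖ ^ 2 / z.1 - ‖z.2‖ * ‖y k‖
        = (z.1 * ‖y k‖ / 2 - ‖z.2‖) ^ 2 / z.1 := by field_simp; ring
      have : 0 ≤ (z.1 * ‖y k‖ / 2 - ‖z.2‖) ^ 2 / z.1 := by positivity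
      linarith
    have h7 : ‖y k‖ ^ 2 ≤ 4 * (‖z.2‖ ^ 2 / z.1 + |1 - c - G u z|) / z.1 := by
      rw [le_div_iff₀ hz]
      linarith
    nlinarith [sq_nonneg (‖y k‖ - 1)]
  obtain ⟨y0, -, φ, hφ, hlim⟩ := (isCompact_closedBall _ _).tendsto_subseq hbd
  refine ⟨y0, fun w hw => ?_⟩
  have h1 : Tendsto (fun k => G u z - 1 / ((φ k : ℝ) + 1) + aff (y (φ k)) (w - z)) atTop
      (𝓝 (G u z - 0 + aff y0 (w - z))) := by
    refine Tendsto.add (Tendsto.sub tendsto_const_nhds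
      ((tendsto_one_div_add_atTop_nhds_zero_nat (𝕜 := ℝ)).comp hφ.tendsto_atTop)) ?_
    have hc : Continuous fun y : E => aff y (w - z) := by unfold aff; fun_prop
    exact (hc.tendsto y0).comp hlim
  rw [sub_zero] at h1
  refine le_of_tendsto h1 (Eventually.of_forall fun k => ?_)
  have := hy (φ k)
  have := G_ge u ⟨c, hc⟩ w hw (y (φ k))
  rw [aff_sub]
  linarith

/-- differential form of `aff` -/
noncomputable def affL (y : E) : (ℝ × E) →L[ℝ] ℝ :=
  (innerSL ℝ y).comp (ContinuousLinearMap.snd ℝ ℝ E)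
    - (‖y‖ ^ 2 / 2) • ContinuousLinearMap.fst ℝ ℝ E

lemma affL_apply (y : E) (z : ℝ × E) : affL y z = aff y z := by
  simp [affL, aff, real_inner_comm]; ring

lemma pos_nhds (z : ℝ × E) (hz : 0 < z.1) : ∀ᶠ w : ℝ × E in 𝓝 z, 0 < w.1 :=
  (isOpen_lt continuous_const continuous_fst).mem_nhds hz

lemma hasFDerivAt_of_cal (u : E → ℝ) (z : ℝ × E) (hz : 0 < z.1)
    (hd : DifferentiableAt ℝ (G u) z) (y : E) (hy : Cal u z y) : HasFDerivAt (G u) (affL y) z := by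
  have h1 := hd.hasFDerivAt
  have h2 : HasFDerivAt (fun w => G u w - affL y w) (fderiv ℝ (G u) z - affL y) z :=
    h1.sub (affL y).hasFDerivAt
  have h3 : IsLocalMin (fun w => G u w - affL y w) z := by
    filter_upwards [pos_nhds z hz] with w hw
    have := hy w hw
    rw [aff_sub] at this
    simp only [affL_apply]
    linarith
  have h4 := h3.hasFDerivAt_eq_zero h2
  rw [sub_eq_zero] at h4
  rwa [h4] at h1

/-- squeeze -/
lemma diff_of_squeeze {X : Type*} [NormedAddCommGroup X] [NormedSpace ℝ X] (g h : X → ℝ)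
    (L : X →L[ℝ] ℝ) (c : ℝ) (a : X) (hh : DifferentiableAt ℝ h a)
    (h1 : ∀ᶠ x in 𝓝 a, L x + c ≤ g x) (h2 : ∀ᶠ x in 𝓝 a, g x ≤ h x)
    (h3 : h a = L a + c) : DifferentiableAt ℝ g a := by
  have hga : g a = L a + c := le_antisymm (h3 ▸ h2.self_of_nhds) h1.self_of_nhds
  have hd : HasFDerivAt (fun x => h x - L x) (fderiv ℝ h a - L) a :=
    hh.hasFDerivAt.sub L.hasFDerivAt
  have hm : IsLocalMin (fun x => h x - L x) a := by
    filter_upwards [h1, h2] with x hx1 hx2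
    linarith
  have h0 := hm.hasFDerivAt_eq_zero hd
  rw [h0] at hd
  refine ⟨L, ?_⟩
  rw [hasFDerivAt_iff_isLittleO] at hd ⊢
  refine Asymptotics.IsBigO.trans_isLittleO ?_ hd
  refine Asymptotics.IsBigO.of_bound 1 ?_
  filter_upwards [h1, h2] with x hx1 hx2
  simp only [map_sub, zero_apply, Real.norm_eq_abs, one_mul]
  rw [abs_of_nonneg (by linarith), abs_of_nonneg (by linarith)]
  linarith

lemma diff_of_cal (u : E → ℝ) (hb : BddBelow (Set.range u)) (z : ℝ × E) (hz : 0 < z.1)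
    (y : E) (hy : Cal u z y) (d : ℝ) (hd : 0 < d) :
    DifferentiableAt ℝ (G u) (z.1 + d, z.2 + d • y) := by
  refine diff_of_squeeze (G u) (fun w => G u z + ‖w.2 - z.2‖ ^ 2 / (2 * (w.1 - z.1)))
    (affL y) (G u z - aff y z) _ ?_ ?_ ?_ ?_
  · have : (2 * (((z.1 + d, z.2 + d • y) : ℝ × E).1 - z.1)) ≠ 0 := by simp; positivity
    have h1 : DifferentiableAt ℝ (fun w : ℝ × E => ‖w.2 - z.2‖ ^ 2) (z.1 + d, z.2 + d • y) :=
      DifferentiableAt.norm_sq ℝ (by fun_prop)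
    have h2 : DifferentiableAt ℝ (fun w : ℝ × E => 2 * (w.1 - z.1)) (z.1 + d, z.2 + d • y) := by
      fun_prop
    have h3 := h1.mul (h2.inv this)
    exact (differentiableAt_const _).add h3
  · filter_upwards [pos_nhds ((z.1 + d, z.2 + d • y) : ℝ × E) (by simp; linarith)] with w hw
    have := hy w hw
    rw [aff_sub] at this
    rw [affL_apply]; linarith
  · have : ∀ᶠ w : ℝ × E in 𝓝 (z.1 + d, z.2 + d • y), z.1 < w.1 :=
      (isOpen_lt continuous_const continuous_fst).mem_nhds (by simpa using hd)
    filter_upwards [this] with w hw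
    exact G_HL u hb z w hz hw
  · simp only [affL_apply, aff, add_sub_cancel_left, norm_smul, inner_add_left,
      real_inner_smul_left, real_inner_self_eq_norm_sq, mul_pow, Real.norm_eq_abs, sq_abs]
    field_simp
    ring

/-- the functional minimized by the proximal map -/
noncomputable def Phi (u : E → ℝ) (z : ℝ × E) (d : ℝ) (m : E) : ℝ :=
  d * G u (z.1 - d, m) + ‖m - z.2‖ ^ 2 / 2

lemma G_lower (u : E → ℝ) (hb : BddBelow (Set.range u)) (z : ℝ × E) (hz : 0 < z.1) :
    - u 0 ≤ G u z := by
  have := G_ge u hb z hz 0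
  simpa [aff] using this

lemma prox_bound (u : E → ℝ) (hb : BddBelow (Set.range u)) (z : ℝ × E) (d : ℝ) (hd : 0 ≤ d)
    (hdz : d < z.1) (m : E) (hm : Phi u z d m ≤ Phi u z d z.2) :
    ‖m - z.2‖ ^ 2 ≤ 2 * (d * (G u (z.1 - d, z.2) + u 0)) := by
  have h := mul_le_mul_of_nonneg_left (G_lower u hb (z.1 - d, m) (by simpa using hdz)) hd
  simp only [Phi, sub_self, norm_zero] at hm
  nlinarith

lemma exists_prox (u : E → ℝ) (hb : BddBelow (Set.range u)) (z : ℝ × E) (d : ℝ) (hd : 0 ≤ d)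
    (hdz : d < z.1) : ∃ m, ∀ m', Phi u z d m ≤ Phi u z d m' := by
  set R := Real.sqrt (2 * (d * (G u (z.1 - d, z.2) + u 0))) with hR
  have hcont : Continuous (Phi u z d) := by
    unfold Phi
    have : Continuous fun m : E => G u (z.1 - d, m) :=
      (G_cont u hb).comp_continuous (by fun_prop) (fun m => by simpa using hdz)
    fun_prop
  obtain ⟨m, hm, hmin⟩ := (isCompact_closedBall z.2 R).exists_isMinOn
    ⟨z.2, Metric.mem_closedBall_self (Real.sqrt_nonneg _)⟩ hcont.continuousOn
  refine ⟨m, fun m' => ?_⟩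
  by_cases h : Phi u z d m' ≤ Phi u z d z.2
  · apply hmin
    rw [Metric.mem_closedBall, dist_eq_norm]
    exact Real.le_sqrt_of_sq_le (prox_bound u hb z d hd hdz m' h)
  · exact (hmin (Metric.mem_closedBall_self (Real.sqrt_nonneg _))).trans (not_le.1 h).le

lemma prox_unique (u : E → ℝ) (hb : BddBelow (Set.range u)) (z : ℝ × E) (d : ℝ) (hd : 0 ≤ d)
    (hdz : d < z.1) (m m' : E) (hm : ∀ a, Phi u z d m ≤ Phi u z d a)
    (hm' : ∀ a, Phi u z d m' ≤ Phi u z d a) : m = m' := by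
  have h1 := hm ((1 / 2 : ℝ) • m + (1 / 2 : ℝ) • m')
  have h2 := hm m'
  have h2' := hm' m
  have hc := (G_convex u hb).2 (show ((z.1 - d, m) : ℝ × E) ∈ _ by simpa using hdz)
    (show ((z.1 - d, m') : ℝ × E) ∈ _ by simpa using hdz) (show (0 : ℝ) ≤ 1 / 2 by norm_num)
    (show (0 : ℝ) ≤ 1 / 2 by norm_num) (by norm_num)
  have he : (1 / 2 : ℝ) • ((z.1 - d, m) : ℝ × E) + (1 / 2 : ℝ) • (z.1 - d, m')
      = (z.1 - d, (1 / 2 : ℝ) • m + (1 / 2 : ℝ) • m') := by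
    ext
    · simp; ring
    · simp
  rw [he] at hc
  simp only [smul_eq_mul] at hc
  have hp := parallelogram_law_with_norm ℝ (m - z.2) (m' - z.2)
  have e1 : (m - z.2) - (m' - z.2) = m - m' := by abel
  have e2 : (m - z.2) + (m' - z.2) = (2 : ℝ) • ((1 / 2 : ℝ) • m + (1 / 2 : ℝ) • m' - z.2) := by
    module
  rw [e1, e2, norm_smul] at hp
  norm_num at hp
  have hc' := mul_le_mul_of_nonneg_left hc hd
  unfold Phi at h1 h2 h2'
  norm_num at h1 hc' 
  have : ‖m - m'‖ = 0 := by
    have : ‖m - m'‖ * ‖m - m'‖ ≤ 0 := by nlinarith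
    nlinarith [norm_nonneg (m - m')]
  rwa [norm_eq_zero, sub_eq_zero] at this

open Classical in
noncomputable def prox (u : E → ℝ) (z : ℝ × E) (d : ℝ) : E :=
  if h : ∃ m, ∀ m', Phi u z d m ≤ Phi u z d m' then h.choose else 0

lemma prox_spec (u : E → ℝ) (hb : BddBelow (Set.range u)) (z : ℝ × E) (d : ℝ) (hd : 0 ≤ d)
    (hdz : d < z.1) : ∀ m', Phi u z d (prox u z d) ≤ Phi u z d m' := by
  have h := exists_prox u hb z d hd hdz
  rw [prox, dif_pos h]
  exact h.choose_spec

def Dom : Set ((ℝ × E) × ℝ) := {a | 0 ≤ a.2 ∧ a.2 < a.1.1}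

lemma prox_cont (u : E → ℝ) (hb : BddBelow (Set.range u)) :
    ContinuousOn (fun a : (ℝ × E) × ℝ => prox u a.1 a.2) Dom := by
  intro a ha
  have hA : ∀ᶠ b in 𝓝[Dom] a, b ∈ Dom (E := E) := self_mem_nhdsWithin
  have hg : ∀ (f : (ℝ × E) × ℝ → E), ∀ g : Filter ((ℝ × E) × ℝ), g ≤ 𝓝 a → ∀ y : E,
      Tendsto f g (𝓝 y) → Tendsto (fun b => Phi u b.1 b.2 (f b)) g (𝓝 (Phi u a.1 a.2 y)) := by
    intro f g hg y hf
    have hid : Tendsto (fun b : (ℝ × E) × ℝ => b) g (𝓝 a) := hg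
    have t1 : Tendsto (fun b : (ℝ × E) × ℝ => b.1.1) g (𝓝 a.1.1) :=
      (show Continuous fun b : (ℝ × E) × ℝ => b.1.1 by fun_prop).continuousAt.tendsto.mono_left hid
    have t2 : Tendsto (fun b : (ℝ × E) × ℝ => b.1.2) g (𝓝 a.1.2) :=
      (show Continuous fun b : (ℝ × E) × ℝ => b.1.2 by fun_prop).continuousAt.tendsto.mono_left hid
    have t3 : Tendsto (fun b : (ℝ × E) × ℝ => b.2) g (𝓝 a.2) :=
      (show Continuous fun b : (ℝ × E) × ℝ => b.2 by fun_prop).continuousAt.tendsto.mono_left hid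
    have t4 : Tendsto (fun b => ((b.1.1 - b.2, f b) : ℝ × E)) g (𝓝 (a.1.1 - a.2, y)) :=
      (t1.sub t3).prodMk_nhds hf
    have t5 := (G_contAt u hb (a.1.1 - a.2, y) (by simpa using ha.2)).tendsto.comp t4
    exact (t3.mul t5).add (((hf.sub t2).norm.pow 2).div_const 2)
  -- local bound
  have hbd : ∀ᶠ b in 𝓝[Dom] a, prox u b.1 b.2 ∈ Metric.closedBall (a.1.2)
      (2 + (1 + 2 * (Phi u a.1 a.2 a.1.2 + a.2 * u 0))) := by
    have t1 : Tendsto (fun b : (ℝ × E) × ℝ => 2 * (Phi u b.1 b.2 b.1.2 + b.2 * u 0)) (𝓝[Dom] a)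
        (𝓝 (2 * (Phi u a.1 a.2 a.1.2 + a.2 * u 0))) := by
      have t2 : Tendsto (fun b : (ℝ × E) × ℝ => b.1.2) (𝓝[Dom] a) (𝓝 a.1.2) :=
        ((Continuous.tendsto (by fun_prop) a)).mono_left nhdsWithin_le_nhds
      have t3 : Tendsto (fun b : (ℝ × E) × ℝ => b.2) (𝓝[Dom] a) (𝓝 a.2) :=
        ((Continuous.tendsto (by fun_prop) a)).mono_left nhdsWithin_le_nhds
      exact ((hg _ _ nhdsWithin_le_nhds _ t2).add (t3.mul_const _)).const_mul 2
    have t2 : Tendsto (fun b : (ℝ × E) × ℝ => b.1.2) (𝓝[Dom] a) (𝓝 a.1.2) :=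
      ((Continuous.tendsto (by fun_prop) a)).mono_left nhdsWithin_le_nhds
    filter_upwards [hA, t1.eventually (gt_mem_nhds (lt_add_one _)),
      t2.eventually (Metric.ball_mem_nhds _ one_pos)] with b hb1 hb2 hb3
    have h1 := prox_bound u hb b.1 b.2 hb1.1 hb1.2 _ (prox_spec u hb b.1 b.2 hb1.1 hb1.2 _)
    have h2 : ‖prox u b.1 b.2 - b.1.2‖ ^ 2 ≤ 2 * (Phi u b.1 b.2 b.1.2 + b.2 * u 0) := by
      refine h1.trans (le_of_eq ?_)
      simp [Phi]; ring
    rw [Metric.mem_closedBall]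
    have h3 := dist_triangle (prox u b.1 b.2) b.1.2 a.1.2
    rw [dist_eq_norm (prox u b.1 b.2) b.1.2] at h3
    nlinarith [sq_nonneg (‖prox u b.1 b.2 - b.1.2‖ - 1)]
  change Tendsto _ _ _
  rw [tendsto_iff_ultrafilter]
  intro g hgle
  have hcomp := (isCompact_closedBall a.1.2 _).ultrafilter_le_nhds
    (g.map fun b => prox u b.1 b.2) (by
      rw [le_principal_iff]
      exact hgle hbd)
  obtain ⟨y, -, hy⟩ := hcomp
  have hy' : Tendsto (fun b : (ℝ × E) × ℝ => prox u b.1 b.2) g (𝓝 y) := hy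
  have hg0 : (g : Filter _) ≤ 𝓝 a := hgle.trans nhdsWithin_le_nhds
  have : y = prox u a.1 a.2 := by
    refine prox_unique u hb a.1 a.2 ha.1 ha.2 _ _ (fun m => ?_) (prox_spec u hb _ _ ha.1 ha.2)
    refine le_of_tendsto_of_tendsto (hg _ _ hg0 _ hy') (hg (fun _ => m) _ hg0 m tendsto_const_nhds) ?_
    filter_upwards [hgle hA] with b hb1
    exact prox_spec u hb b.1 b.2 hb1.1 hb1.2 m
  rw [this] at hy'
  exact hy'

noncomputable def P (u : E → ℝ) (a : (ℝ × E) × ℝ) : ℝ × E := (a.1.1 - a.2, prox u a.1 a.2)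

lemma P_cont (u : E → ℝ) (hb : BddBelow (Set.range u)) : ContinuousOn (P u) Dom := by
  have := prox_cont u hb
  unfold P
  exact ContinuousOn.prodMk (by fun_prop) this

lemma P_zero (u : E → ℝ) (hb : BddBelow (Set.range u)) (z : ℝ × E) (hz : 0 < z.1) :
    P u (z, 0) = z := by
  have h := prox_spec u hb z 0 le_rfl hz z.2
  have h2 := prox_bound u hb z 0 le_rfl hz _ h
  have h3 : ‖prox u z 0 - z.2‖ = 0 := by
    simp only [zero_mul, mul_zero] at h2
    exact pow_eq_zero_iff (two_ne_zero) |>.1 (le_antisymm h2 (by positivity))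
  rw [norm_eq_zero, sub_eq_zero] at h3
  ext1
  · simp [P]
  · simpa [P] using h3

/-- calibrated image -/
def Q (u : E → ℝ) (d : ℝ) (z : ℝ × E) : Prop := Cal u (P u (z, d)) (d⁻¹ • (z.2 - prox u z d))

lemma Q_of_diff (u : E → ℝ) (hb : BddBelow (Set.range u)) (z : ℝ × E) (d : ℝ) (hd : 0 < d)
    (hdz : d < z.1) (h : DifferentiableAt ℝ (G u) (P u (z, d))) : Q u d z := by
  have hpos : 0 < (P u (z, d)).1 := by simpa [P] using hdz
  obtain ⟨y, hy⟩ := exists_cal u hb (P u (z, d)) hpos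
  have hD := hasFDerivAt_of_cal u _ hpos h y hy
  set m := prox u z d with hm
  have hD2 : HasFDerivAt (fun a : E => G u (z.1 - d, a))
      ((affL y).comp ((0 : E →L[ℝ] ℝ).prod (ContinuousLinearMap.id ℝ E))) m := by
    have hin : HasFDerivAt (fun a : E => ((z.1 - d, a) : ℝ × E))
      ((0 : E →L[ℝ] ℝ).prod (ContinuousLinearMap.id ℝ E)) m :=
      (hasFDerivAt_const _ _).prodMk (hasFDerivAt_id _)
    exact HasFDerivAt.comp (g := G u) m hD hin
  have hD3 : HasFDerivAt (fun a : E => ‖a - z.2‖ ^ 2)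
      (2 • (innerSL ℝ (m - z.2)).comp (ContinuousLinearMap.id ℝ E)) m :=
    ((hasFDerivAt_id m).sub_const z.2).norm_sq
  have hD4 : HasFDerivAt (Phi u z d) _ m := (hD2.const_mul d).add (hD3.mul_const (1 / 2 : ℝ) |>.congr_of_eventuallyEq
    (Eventually.of_forall fun a => by simp only; ring : (fun a : E => ‖a - z.2‖ ^ 2 / 2) =ᶠ[𝓝 m] _))
  have hmin : IsLocalMin (Phi u z d) m :=
    Eventually.of_forall (prox_spec u hb z d hd.le hdz)
  have h0 := hmin.hasFDerivAt_eq_zero hD4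
  have h1 := congrArg (fun L : E →L[ℝ] ℝ => L (d • y + (m - z.2))) h0
  have h2 : inner ℝ (d • y + (m - z.2)) (d • y + (m - z.2)) = 0 := by
    simp [affL_apply, aff] at h1
    rw [← h1, inner_add_left (d • y), real_inner_smul_left, real_inner_comm _ y]
    rw [inner_sub_left]
  rw [inner_self_eq_zero] at h2
  have h3 : d⁻¹ • (z.2 - m) = y := by
    rw [inv_smul_eq_iff₀ hd.ne']
    have : d • y = -(m - z.2) := eq_neg_of_add_eq_zero_left h2
    rw [this]; abel
  rw [Q, h3]
  exact hy

lemma diff_of_Q (u : E → ℝ) (hb : BddBelow (Set.range u)) (z : ℝ × E) (d : ℝ) (hd : 0 < d)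
    (hdz : d < z.1) (h : Q u d z) : DifferentiableAt ℝ (G u) z := by
  have := diff_of_cal u hb _ (by simpa [P] using hdz) _ h d hd
  have e : (((P u (z, d)).1 + d, (P u (z, d)).2 + d • d⁻¹ • (z.2 - prox u z d)) : ℝ × E) = z := by
    rw [smul_inv_smul₀ hd.ne']
    ext1 <;> simp [P]
  rwa [e] at this

lemma notQ_eventually (u : E → ℝ) (hb : BddBelow (Set.range u)) (z : ℝ × E) (d : ℝ) (hd : 0 < d)
    (hdz : d < z.1) (h : ¬ Q u d z) : ∀ᶠ w in 𝓝 z, ¬ Q u d w := by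
  unfold Q Cal at h
  push Not at h
  obtain ⟨w, hw, hlt⟩ := h
  have hev : ∀ᶠ v : ℝ × E in 𝓝 z, d < v.1 :=
    (isOpen_lt continuous_const continuous_fst).mem_nhds hdz
  have hin : Tendsto (fun v : ℝ × E => (v, d)) (𝓝 z) (𝓝[Dom] (z, d)) := by
    rw [tendsto_nhdsWithin_iff]
    refine ⟨Continuous.tendsto (by fun_prop) z, ?_⟩
    filter_upwards [hev] with v hv
    exact ⟨hd.le, hv⟩
  have hmem : (z, d) ∈ Dom (E := E) := ⟨hd.le, hdz⟩
  have c1 : ContinuousAt (fun v => P u (v, d)) z := (P_cont u hb _ hmem).tendsto.comp hin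
  have c2 : ContinuousAt (fun v => prox u v d) z := (prox_cont u hb _ hmem).tendsto.comp hin
  have c3 : ContinuousAt (fun v => G u (P u (v, d))) z :=
    ContinuousAt.comp (g := G u) (G_contAt u hb _ (by simpa [P] using hdz)) c1
  have c4 : ContinuousAt (fun v => G u (P u (v, d)) +
      aff (d⁻¹ • (v.2 - prox u v d)) (w - P u (v, d))) z := by
    have c5 : ContinuousAt (fun v : ℝ × E => d⁻¹ • (v.2 - prox u v d)) z :=
      (continuousAt_snd.sub c2).const_smul _
    have c6 : ContinuousAt (fun v : ℝ × E => w - P u (v, d)) z := continuousAt_const.sub c1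
    have hc : Continuous fun q : E × (ℝ × E) => aff q.1 q.2 := by unfold aff; fun_prop
    exact c3.add (ContinuousAt.comp (g := fun q : E × (ℝ × E) => aff q.1 q.2)
      hc.continuousAt (c5.prodMk c6))
  filter_upwards [c4.eventually (lt_mem_nhds hlt)] with v hv hQ
  exact absurd (hQ w hw) (not_le.2 hv)

def Sing (u : E → ℝ) : Set (ℝ × E) := {z | 0 < z.1 ∧ ¬ DifferentiableAt ℝ (G u) z}

lemma P_sing (u : E → ℝ) (hb : BddBelow (Set.range u)) (z : ℝ × E) (d : ℝ) (hd : 0 ≤ d)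
    (hdz : d < z.1) (h : z ∈ Sing u) : P u (z, d) ∈ Sing u := by
  rcases hd.eq_or_lt with rfl | hd
  · rwa [P_zero u hb z hdz]
  · refine ⟨by simpa [P] using hdz, fun h2 => h.2 ?_⟩
    exact diff_of_Q u hb z d hd hdz (Q_of_diff u hb z d hd hdz h2)

lemma P_sing_ev (u : E → ℝ) (hb : BddBelow (Set.range u)) (z : ℝ × E) (d : ℝ) (hd : 0 < d)
    (hdz : d < z.1) (h : z ∈ Sing u) : ∀ᶠ w in 𝓝 z, P u (w, d) ∈ Sing u := by
  have hev : ∀ᶠ v : ℝ × E in 𝓝 z, d < v.1 :=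
    (isOpen_lt continuous_const continuous_fst).mem_nhds hdz
  filter_upwards [hev, notQ_eventually u hb z d hd hdz fun h2 => h.2 (diff_of_Q u hb z d hd hdz h2)]
    with w hw hQ
  exact ⟨by simpa [P] using hw, fun h2 => hQ (Q_of_diff u hb w d hd hw h2)⟩

lemma sing_locContr (u : E → ℝ) (hb : BddBelow (Set.range u)) :
    IsLocallyContractible (Sing u) := by
  intro x V hV
  obtain ⟨V', hV', hVV⟩ := mem_nhds_subtype _ _ _ |>.1 hV
  obtain ⟨z0, hz0⟩ := x
  have hz0' : 0 < z0.1 := hz0.1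
  have hmem : (z0, 0) ∈ Dom (E := E) := ⟨le_rfl, hz0'⟩
  have hPc : ∀ᶠ a in 𝓝[Dom] (z0, (0 : ℝ)), P u a ∈ V' := by
    have := (P_cont u hb _ hmem).tendsto
    rw [P_zero u hb z0 hz0'] at this
    exact this hV'
  rw [eventually_nhdsWithin_iff, Metric.eventually_nhds_iff_ball] at hPc
  obtain ⟨r, hr, hball⟩ := hPc
  set e := min (r / 2) (z0.1 / 2) with he
  have he0 : 0 < e := by positivity
  have her : e < r := lt_of_le_of_lt (min_le_left _ _) (by linarith)
  have hez : e < z0.1 := lt_of_le_of_lt (min_le_right _ _) (by linarith)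
  have hev : ∀ᶠ v : ℝ × E in 𝓝 z0, e < v.1 :=
    (isOpen_lt continuous_const continuous_fst).mem_nhds hez
  obtain ⟨ρ, hρ, hB⟩ := Metric.eventually_nhds_iff_ball.1
    ((P_sing_ev u hb z0 e he0 hez hz0).and (hev.and (Metric.ball_mem_nhds z0 hr)))
  have hPV : ∀ v ∈ Metric.ball z0 ρ, ∀ s ∈ Set.Icc 0 e, (v, s) ∈ Dom (E := E) ∧ P u (v, s) ∈ V' := by
    intro v hv s hs
    have hD : (v, s) ∈ Dom (E := E) := ⟨hs.1, hs.2.trans_lt (hB v hv).2.1⟩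
    refine ⟨hD, hball _ ?_ hD⟩
    rw [← ball_prod_same]
    refine ⟨(hB v hv).2.2, ?_⟩
    rw [Metric.mem_ball, Real.dist_eq, sub_zero, abs_of_nonneg hs.1]
    exact hs.2.trans_lt her
  -- the homotopy
  let K : (ℝ × E) × ℝ → (ℝ × E) × ℝ := fun a =>
    (z0 + (min 1 (2 - 2 * a.2)) • (a.1 - z0), e * min 1 (2 * a.2))
  have hK : Continuous K := by fun_prop
  have hKb : ∀ w ∈ Metric.ball z0 ρ, ∀ t ∈ Set.Icc (0 : ℝ) 1,
      (K (w, t)).1 ∈ Metric.ball z0 ρ ∧ (K (w, t)).2 ∈ Set.Icc 0 e := by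
    intro w hw t ht
    have h1 : 0 ≤ min 1 (2 - 2 * t) := le_min zero_le_one (by linarith [ht.2])
    have h2 : min 1 (2 - 2 * t) ≤ 1 := min_le_left _ _
    have h3 : 0 ≤ min 1 (2 * t) := le_min zero_le_one (by linarith [ht.1])
    have h4 : min 1 (2 * t) ≤ 1 := min_le_left _ _
    refine ⟨?_, ?_, ?_⟩
    · simp only [K, Metric.mem_ball, dist_eq_norm, add_sub_cancel_left, norm_smul,
        Real.norm_eq_abs, abs_of_nonneg h1] at hw ⊢
      nlinarith [norm_nonneg (w - z0)]
    · simp only [K]; positivity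
    · simp only [K]; nlinarith
  have hKS : ∀ w ∈ Metric.ball z0 ρ, w ∈ Sing u → ∀ t ∈ Set.Icc (0 : ℝ) 1,
      P u (K (w, t)) ∈ Sing u := by
    intro w hw hwS t ht
    have hb' := hKb w hw t ht
    rcases le_total t (1 / 2) with h | h
    · have h1 : (K (w, t)).1 = w := by
        simp only [K]; rw [min_eq_left (by linarith)]; simp
      have := P_sing u hb w (K (w, t)).2 hb'.2.1 (hb'.2.2.trans_lt (hB w hw).2.1) hwS
      have h2 : K (w, t) = (w, (K (w, t)).2) := Prod.ext h1 rfl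
      rw [h2]
      exact this
    · have h1 : (K (w, t)).2 = e := by
        simp only [K]; rw [min_eq_left (by linarith)]; simp
      have := (hB _ hb'.1).1
      rw [← h1] at this
      simpa only using this
  have hKV : ∀ w ∈ Metric.ball z0 ρ, ∀ t ∈ Set.Icc (0 : ℝ) 1,
      K (w, t) ∈ Dom (E := E) ∧ P u (K (w, t)) ∈ V' := by
    intro w hw t ht
    have hb' := hKb w hw t ht
    exact hPV _ hb'.1 _ hb'.2
  have hK0 : ∀ w, K (w, 0) = (w, 0) := by intro w; simp [K]
  have hK1 : ∀ w, K (w, 1) = (z0, e) := by intro w; simp [K]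
  have hWV : ∀ w : Sing u, w.1 ∈ Metric.ball z0 ρ → w ∈ V := by
    intro w hw
    apply hVV
    have := (hKV w.1 hw 0 (by simp)).2
    rw [hK0, P_zero u hb _ w.2.1] at this
    exact this
  refine ⟨Subtype.val ⁻¹' Metric.ball z0 ρ,
    continuous_subtype_val.continuousAt.preimage_mem_nhds (Metric.ball_mem_nhds _ hρ),
    fun w hw => hWV w hw, ?_⟩
  refine ⟨⟨fun a => ⟨⟨P u (K (a.1.1.1, a.2.1)), hKS _ a.1.2 a.1.1.2 _ a.2.2⟩,
    hVV (hKV _ a.1.2 _ a.2.2).2⟩, ?_⟩, ?_, ?_⟩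
  · refine Continuous.subtype_mk (Continuous.subtype_mk ?_ _) _
    refine (P_cont u hb).comp_continuous (hK.comp (by fun_prop)) ?_
    intro a
    exact (hKV _ a.1.2 _ a.2.2).1
  · intro w
    apply Subtype.ext
    simp only [ContinuousMap.coe_mk, Set.Icc.coe_zero]
    rw [hK0, P_zero u hb _ w.1.2.1]
  · have hz := hKV z0 (Metric.mem_ball_self hρ) 1 (by simp)
    have hs := hKS z0 (Metric.mem_ball_self hρ) hz0 1 (by simp)
    refine ⟨⟨⟨_, hs⟩, hVV hz.2⟩, fun w => ?_⟩
    apply Subtype.ext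
    apply Subtype.ext
    simp only [ContinuousMap.coe_mk, Set.Icc.coe_one]
    rw [hK1, hK1]

end

lemma IsLocallyContractible.of_homeo {S T : Type*} [TopologicalSpace S] [TopologicalSpace T]
    (e : S ≃ₜ T) (h : IsLocallyContractible T) : IsLocallyContractible S := by
  intro x V hV
  obtain ⟨W, hW, hWV, F, hF0, p, hp⟩ := h (e x) (e.symm ⁻¹' V)
    (e.symm.continuous.continuousAt.preimage_mem_nhds (by simpa using hV))
  refine ⟨e ⁻¹' W, e.continuous.continuousAt.preimage_mem_nhds hW,
    fun w hw => by simpa using hWV hw, ?_⟩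
  refine ⟨⟨fun a => ⟨e.symm (F (⟨e a.1.1, a.1.2⟩, a.2)).1, (F (⟨e a.1.1, a.1.2⟩, a.2)).2⟩, ?_⟩, ?_, ?_⟩
  · fun_prop
  · intro w
    simp [hF0]
  · refine ⟨⟨e.symm p.1, p.2⟩, fun w => ?_⟩
    simp [hp]

section
variable {n : ℕ}

local notation "EE" => EuclideanSpace ℝ (Fin n)

noncomputable def T (z : ℝ × EE) : ℝ × EE := (z.1⁻¹, z.1⁻¹ • z.2)

lemma T_pos (z : ℝ × EE) (hz : 0 < z.1) : 0 < (T z).1 := inv_pos.2 hz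

lemma T_T (z : ℝ × EE) (hz : 0 < z.1) : T (T z) = z := by
  ext1
  · simp [T]
  · simp [T, hz.ne']

lemma T_diff (z : ℝ × EE) (hz : 0 < z.1) : DifferentiableAt ℝ (T (n := n)) z := by
  unfold T
  have : DifferentiableAt ℝ (fun z : ℝ × EE => z.1⁻¹) z := differentiableAt_fst.inv hz.ne'
  exact this.prodMk (this.smul differentiableAt_snd)

lemma hopfLax_eq (u : EE → ℝ) (hb : BddBelow (Set.range u)) (z : ℝ × EE) (hz : 0 < z.1) :
    hopfLax n u z = ‖z.2‖ ^ 2 / (2 * z.1) - G u (T z) := by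
  have key : ∀ y, u y + ‖z.2 - y‖ ^ 2 / (2 * z.1)
      = ‖z.2‖ ^ 2 / (2 * z.1) - (aff y (T z) - u y) := by
    intro y
    simp only [aff, T, real_inner_smul_left, norm_sub_sq_real]
    field_simp
    ring
  unfold hopfLax
  have hbd : BddBelow (Set.range fun y => u y + ‖z.2 - y‖ ^ 2 / (2 * z.1)) := by
    obtain ⟨c, hc⟩ := hb
    refine ⟨c, ?_⟩
    rintro _ ⟨y, rfl⟩
    have h1 := hc ⟨y, rfl⟩
    have h2 : 0 ≤ ‖z.2 - y‖ ^ 2 / (2 * z.1) := by positivity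
    simp only
    linarith
  apply le_antisymm
  · rw [le_sub_comm]
    apply G_le
    intro y
    have := ciInf_le hbd y
    have k := key y
    linarith
  · apply le_ciInf
    intro y
    rw [key y]
    have := G_ge u hb (T z) (T_pos z hz) y
    linarith

lemma diff_iff (u : EE → ℝ) (hb : BddBelow (Set.range u)) (z : ℝ × EE) (hz : 0 < z.1) :
    DifferentiableAt ℝ (hopfLax n u) z ↔ DifferentiableAt ℝ (G u) (T z) := by
  have hq : ∀ z : ℝ × EE, 0 < z.1 →
      DifferentiableAt ℝ (fun z : ℝ × EE => ‖z.2‖ ^ 2 / (2 * z.1)) z := by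
    intro z hz
    have h1 : DifferentiableAt ℝ (fun w : ℝ × EE => ‖w.2‖ ^ 2) z :=
      DifferentiableAt.norm_sq ℝ (by fun_prop)
    have h2 : DifferentiableAt ℝ (fun w : ℝ × EE => 2 * w.1) z := by
      fun_prop
    exact h1.mul (h2.inv (by positivity))
  constructor
  · intro h
    have h1 : DifferentiableAt ℝ (fun z : ℝ × EE => ‖z.2‖ ^ 2 / (2 * z.1) - hopfLax n u z) (T (T z)) := by
      rw [T_T z hz]
      exact (hq z hz).sub h
    have h2 := DifferentiableAt.comp (T z) h1 (T_diff (T z) (T_pos z hz))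
    refine h2.congr_of_eventuallyEq ?_
    filter_upwards [pos_nhds (T z) (T_pos z hz)] with w hw
    simp only [Function.comp_apply]
    rw [hopfLax_eq u hb _ (T_pos w hw), T_T w hw]
    ring
  · intro h
    have h2 := (hq z hz).sub (DifferentiableAt.comp z h (T_diff z hz))
    refine h2.congr_of_eventuallyEq ?_
    filter_upwards [pos_nhds z hz] with w hw
    exact hopfLax_eq u hb w hw

noncomputable def singHomeo (u : EE → ℝ) (hb : BddBelow (Set.range u)) :
    {p : ℝ × EE | 0 < p.1 ∧ ¬ DifferentiableAt ℝ (hopfLax n u) p} ≃ₜ Sing u where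
  toFun z := ⟨T z.1, T_pos _ z.2.1, fun h => z.2.2 ((diff_iff u hb _ z.2.1).2 h)⟩
  invFun z := ⟨T z.1, T_pos _ z.2.1, fun h => z.2.2 (by
    have := (diff_iff u hb _ (T_pos _ z.2.1)).1 h
    rwa [T_T _ z.2.1] at this)⟩
  left_inv z := Subtype.ext (T_T _ z.2.1)
  right_inv z := Subtype.ext (T_T _ z.2.1)
  continuous_toFun := by
    refine Continuous.subtype_mk ?_ _
    rw [continuous_iff_continuousAt]
    intro z
    exact ContinuousAt.comp (g := T) (T_diff z.1 z.2.1).continuousAt continuous_subtype_val.continuousAt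
  continuous_invFun := by
    refine Continuous.subtype_mk ?_ _
    rw [continuous_iff_continuousAt]
    intro z
    exact ContinuousAt.comp (g := T) (T_diff z.1 z.2.1).continuousAt continuous_subtype_val.continuousAt

end

end HLax

/-- For `u : ℝⁿ → ℝ` bounded below, the set of points of `(0,∞) × ℝⁿ` where the Hopf–Lax
evolution `û` fails to be differentiable is locally contractible. -/
theorem hopfLax_singularities_locallyContractible (n : ℕ)
    (u : EuclideanSpace ℝ (Fin n) → ℝ) (hb : BddBelow (Set.range u)) :
    IsLocallyContractible
      {p : ℝ × EuclideanSpace ℝ (Fin n) |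
        0 < p.1 ∧ ¬ DifferentiableAt ℝ (hopfLax n u) p} :=
  HLax.IsLocallyContractible.of_homeo (HLax.singHomeo u hb) (HLax.sing_locContr u hb)
end

section
/- Let n be a natural number, u : ℝⁿ → ℝ uniformly continuous, and T > 0. Define û(0,x) = u(x) and û(t,x) = ⨅_{y ∈ ℝⁿ} ( u(y) + ‖x − y‖²/(2t) ) for t > 0. Then the inclusion Σ_T(û) ⊆ ((0,T) × ℝⁿ) \ ℐ_T(û) is a homotopy equivalence. -/
open Metric Set intervalIntegral

/-- The negative Lax–Oleinik (Hopf–Lax) evolution of `u` for the quadratic Hamiltonian: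
`û(0,x) = u(x)` and `û(t,x) = inf_y ( u(y) + ‖x - y‖²/(2t) )` for `t > 0`
(values for `t < 0` are irrelevant). -/
noncomputable def hatu (n : ℕ) (u : EuclideanSpace ℝ (Fin n) → ℝ) (t : ℝ)
    (x : EuclideanSpace ℝ (Fin n)) : ℝ :=
  if 0 < t then ⨅ y : EuclideanSpace ℝ (Fin n), (u y + ‖x - y‖ ^ 2 / (2 * t)) else u x

/-- The set `Σ_T(û)` of singularities of `û` in `(0,T) × ℝⁿ`. -/
def sigmaT (n : ℕ) (u : EuclideanSpace ℝ (Fin n) → ℝ) (T : ℝ) :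
    Set (ℝ × EuclideanSpace ℝ (Fin n)) :=
  {p | p.1 ∈ Set.Ioo 0 T ∧
    ¬ DifferentiableAt ℝ (fun q : ℝ × EuclideanSpace ℝ (Fin n) => hatu n u q.1 q.2) p}

/-- The Aubry set `ℐ_T(û)`: points `(t,x)` of `(0,T) × ℝⁿ` through which there passes a
`C¹` curve `γ : [0,T) → ℝⁿ` calibrated by `û` on every subinterval. -/
def aubryT (n : ℕ) (u : EuclideanSpace ℝ (Fin n) → ℝ) (T : ℝ) :
    Set (ℝ × EuclideanSpace ℝ (Fin n)) :=
  {p | p.1 ∈ Set.Ioo 0 T ∧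
    ∃ γ γ' : ℝ → EuclideanSpace ℝ (Fin n),
      (∀ s ∈ Set.Ico (0 : ℝ) T, HasDerivAt γ (γ' s) s) ∧
      ContinuousOn γ' (Set.Ico (0 : ℝ) T) ∧ γ p.1 = p.2 ∧
      ∀ a b : ℝ, 0 ≤ a → a < b → b < T →
        hatu n u b (γ b) = hatu n u a (γ a) + ∫ s in a..b, (1 / 2) * ‖γ' s‖ ^ 2}

abbrev EE (n : ℕ) := EuclideanSpace ℝ (Fin n)

lemma growth_aux {n : ℕ} {u : EE n → ℝ} {δ : ℝ} 
    (h : ∀ x y, ‖x - y‖ ≤ δ → |u x - u y| ≤ 1) (k : ℕ) :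
    ∀ x y, ‖x - y‖ ≤ (k + 1) * δ → |u x - u y| ≤ k + 1 := by
  induction k with
  | zero => intro x y hxy; simpa using h x y (by simpa using hxy)
  | succ k ih =>
    intro x y hxy
    push_cast at hxy ⊢
    have hk : (0 : ℝ) < k + 1 + 1 := by positivity
    set w : EE n := y + (1 / ((k : ℝ) + 1 + 1)) • (x - y) with hw
    have e1 : w - y = (1 / ((k : ℝ) + 1 + 1)) • (x - y) := by rw [hw]; abel
    have e2 : x - w = (((k : ℝ) + 1) / ((k : ℝ) + 1 + 1)) • (x - y) := by
      have : x - w = (1 - 1 / ((k : ℝ) + 1 + 1)) • (x - y) := by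
        rw [hw, sub_smul, one_smul]; abel
      rw [this]; congr 1; field_simp; ring
    have n1 : ‖w - y‖ ≤ δ := by
      rw [e1, norm_smul, Real.norm_of_nonneg (by positivity), one_div, inv_mul_le_iff₀ hk]
      exact hxy
    have n2 : ‖x - w‖ ≤ (k + 1) * δ := by
      rw [e2, norm_smul, Real.norm_of_nonneg (by positivity), div_mul_eq_mul_div, div_le_iff₀ hk]
      calc ((k : ℝ) + 1) * ‖x - y‖ ≤ (k + 1) * ((k + 1 + 1) * δ) := by gcongr
        _ = _ := by ring
    have := ih x w n2
    have := h w y n1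
    have := abs_sub_le (u x) (u w) (u y)
    linarith

lemma growth_s17 {n : ℕ} {u : EE n → ℝ} (hu : UniformContinuous u) :
    ∃ A B : ℝ, 0 ≤ A ∧ 0 ≤ B ∧ ∀ x y, u x - u y ≤ A + B * ‖x - y‖ := by
  obtain ⟨δ, hδ, h⟩ := Metric.uniformContinuous_iff.1 hu 1 one_pos
  have h' : ∀ x y, ‖x - y‖ ≤ δ / 2 → |u x - u y| ≤ 1 := by
    intro x y hxy
    have := @h x y (by rw [dist_eq_norm]; linarith)
    rw [Real.dist_eq] at this
    exact this.le
  refine ⟨1, 1 / (δ / 2), by norm_num, by positivity, fun x y => ?_⟩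
  have hfl := Nat.lt_floor_add_one (‖x - y‖ / (δ / 2))
  have hfl2 := Nat.floor_le (show 0 ≤ ‖x - y‖ / (δ / 2) by positivity)
  have := growth_aux h' ⌊‖x - y‖ / (δ / 2)⌋₊ x y (by
    rw [div_lt_iff₀ (half_pos hδ)] at hfl; exact hfl.le)
  have h3 := le_abs_self (u x - u y)
  rw [one_div_mul_eq_div]
  linarith

lemma coercive_min {n : ℕ} {f : EE n → ℝ} (hf : Continuous f) (x : EE n) {a b c : ℝ} (ha : 0 < a)
    (h : ∀ y, a * ‖x - y‖ ^ 2 - b * ‖x - y‖ - c ≤ f y) : ∃ z, ∀ y, f z ≤ f y := by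
  refine hf.exists_forall_le_of_isBounded x ?_
  refine (Metric.isBounded_closedBall (x := x) (r := max 1 ((|b| + |c| + |f x|) / a))).subset ?_
  intro y hy
  simp only [Set.mem_ofPred_eq] at hy
  rw [Metric.mem_closedBall, dist_comm, dist_eq_norm]
  by_contra hlt
  push Not at hlt
  obtain ⟨h1, h2⟩ := max_lt_iff.1 hlt
  rw [div_lt_iff₀ ha] at h2
  have := h y
  have hb := le_abs_self b
  have hc := le_abs_self c
  have hfx := le_abs_self (f x)
  have := abs_nonneg b
  have := abs_nonneg c
  have := abs_nonneg (f x)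
  set r := ‖x - y‖
  nlinarith [mul_le_mul_of_nonneg_right hb (by linarith : 0 ≤ r), mul_lt_mul_of_pos_right h2 (by linarith : 0 < r)]

/-- key identity -/
lemma key_id {n : ℕ} (x y z : EE n) {p q : ℝ} (hp : 0 < p) (hq : 0 < q) :
    ‖x - y‖ ^ 2 / (2 * p) + ‖y - z‖ ^ 2 / (2 * q) =
      ‖x - z‖ ^ 2 / (2 * (p + q)) + ‖q • (x - y) - p • (y - z)‖ ^ 2 / (2 * (p * q * (p + q))) := by
  have e : x - z = (x - y) + (y - z) := by abel
  rw [e]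
  generalize x - y = a
  generalize y - z = b
  rw [norm_add_sq_real, norm_sub_sq_real, norm_smul, norm_smul, inner_smul_left, inner_smul_right]
  simp only [mul_pow, Real.norm_eq_abs, sq_abs, conj_trivial]
  field_simp
  ring

lemma key_le {n : ℕ} (x y z : EE n) {p q : ℝ} (hp : 0 < p) (hq : 0 < q) :
    ‖x - z‖ ^ 2 / (2 * (p + q)) ≤ ‖x - y‖ ^ 2 / (2 * p) + ‖y - z‖ ^ 2 / (2 * q) := by
  rw [key_id x y z hp hq]
  have : 0 ≤ ‖q • (x - y) - p • (y - z)‖ ^ 2 / (2 * (p * q * (p + q))) := by positivity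
  linarith

lemma key_eq {n : ℕ} (x y z : EE n) {p q : ℝ} (hp : 0 < p) (hq : 0 < q)
    (h : ‖x - y‖ ^ 2 / (2 * p) + ‖y - z‖ ^ 2 / (2 * q) ≤ ‖x - z‖ ^ 2 / (2 * (p + q))) :
    q • (x - y) = p • (y - z) := by
  rw [key_id x y z hp hq] at h
  have h0 : 0 < 2 * (p * q * (p + q)) := by positivity
  have : ‖q • (x - y) - p • (y - z)‖ ^ 2 / (2 * (p * q * (p + q))) ≤ 0 := by linarith
  rw [div_le_iff₀ h0, zero_mul] at this
  have h2 : ‖q • (x - y) - p • (y - z)‖ = 0 := by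
    have := sq_nonneg ‖q • (x - y) - p • (y - z)‖
    exact pow_eq_zero_iff (two_ne_zero) |>.1 (by linarith)
  exact sub_eq_zero.1 (norm_eq_zero.1 h2)

lemma hatu_bdd {n : ℕ} {u : EE n → ℝ} (hu : UniformContinuous u) {t : ℝ} (ht : 0 < t) (x : EE n) :
    ∃ z, ∀ y, u z + ‖x - z‖ ^ 2 / (2 * t) ≤ u y + ‖x - y‖ ^ 2 / (2 * t) := by
  obtain ⟨A, B, hA, hB, h⟩ := growth_s17 hu
  refine coercive_min (f := fun y => u y + ‖x - y‖ ^ 2 / (2 * t)) (by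
    have := hu.continuous
    fun_prop) x (a := 1 / (2 * t)) (b := B) (c := A - u x) (by positivity) ?_
  intro y
  have := h x y
  have e : 1 / (2 * t) * ‖x - y‖ ^ 2 = ‖x - y‖ ^ 2 / (2 * t) := by ring
  rw [e]
  linarith

lemma hatu_le {n : ℕ} {u : EE n → ℝ} (hu : UniformContinuous u) {t : ℝ} (ht : 0 < t) (x y : EE n) :
    hatu n u t x ≤ u y + ‖x - y‖ ^ 2 / (2 * t) := by
  rw [hatu, if_pos ht]
  obtain ⟨z, hz⟩ := hatu_bdd hu ht x
  exact ciInf_le ⟨_, by rintro _ ⟨y, rfl⟩; exact hz y⟩ y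

lemma hatu_min {n : ℕ} {u : EE n → ℝ} (hu : UniformContinuous u) {t : ℝ} (ht : 0 < t) (x : EE n) :
    ∃ z, hatu n u t x = u z + ‖x - z‖ ^ 2 / (2 * t) := by
  obtain ⟨z, hz⟩ := hatu_bdd hu ht x
  refine ⟨z, le_antisymm (hatu_le hu ht x z) ?_⟩
  rw [hatu, if_pos ht]
  exact le_ciInf hz

lemma hatu_zero {n : ℕ} (u : EE n → ℝ) (x : EE n) : hatu n u 0 x = u x := by
  simp [hatu]

lemma hatu_growth {n : ℕ} {u : EE n → ℝ} (hu : UniformContinuous u) :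
    ∃ A B : ℝ, 0 ≤ A ∧ 0 ≤ B ∧ ∀ t, 0 < t → ∀ x y, hatu n u t x - hatu n u t y ≤ A + B * ‖x - y‖ := by
  obtain ⟨A, B, hA, hB, h⟩ := growth_s17 hu
  refine ⟨A, B, hA, hB, fun t ht x y => ?_⟩
  obtain ⟨z, hz⟩ := hatu_min hu ht y
  have h1 := hatu_le hu ht x (z + (x - y))
  have h2 := h (z + (x - y)) z
  have e1 : x - (z + (x - y)) = y - z := by abel
  have e2 : z + (x - y) - z = x - y := by abel
  rw [e1] at h1
  rw [e2] at h2
  linarith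

lemma hatu_semi {n : ℕ} {u : EE n → ℝ} (hu : UniformContinuous u) {t c : ℝ} (ht : 0 ≤ t) (hc : t < c)
    (x y : EE n) : hatu n u c y ≤ hatu n u t x + ‖y - x‖ ^ 2 / (2 * (c - t)) := by
  rcases ht.eq_or_lt with rfl | ht
  · rw [hatu_zero, sub_zero]; exact hatu_le hu hc y x
  · obtain ⟨z, hz⟩ := hatu_min hu ht x
    have h1 := hatu_le hu (ht.trans hc) y z
    have h2 := key_le y x z (sub_pos.2 hc) ht
    rw [sub_add_cancel] at h2
    linarith

lemma psi_concave {n : ℕ} {u : EE n → ℝ} (hu : UniformContinuous u) :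
    ConcaveOn ℝ {p : ℝ × EE n | 0 < p.1} (fun p => p.1 * hatu n u p.1 p.2 - ‖p.2‖ ^ 2 / 2) := by
  have key : ∀ t : ℝ, 0 < t → ∀ y z : EE n, t * hatu n u t y - ‖y‖ ^ 2 / 2 ≤
      t * u z + ‖z‖ ^ 2 / 2 - inner ℝ y z := by
    intro t ht y z
    have h := mul_le_mul_of_nonneg_left (hatu_le hu ht y z) ht.le
    rw [mul_add, show t * (‖y - z‖ ^ 2 / (2 * t)) = ‖y - z‖ ^ 2 / 2 by field_simp,
      norm_sub_sq_real] at h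
    linarith
  refine ⟨?_, ?_⟩
  · exact (convex_Ioi (0 : ℝ)).linear_preimage (LinearMap.fst ℝ ℝ (EE n))
  · rintro ⟨t, x⟩ ht ⟨s, y⟩ hs a b ha hb hab
    simp only [Set.mem_ofPred_eq] at ht hs
    simp only [Prod.smul_mk, Prod.mk_add_mk, smul_eq_mul]
    have hpos : 0 < a * t + b * s := by
      rcases ha.eq_or_lt with rfl | ha
      · have : b = 1 := by linarith
        subst this; simpa using hs
      · nlinarith [mul_pos ha ht, mul_nonneg hb hs.le]
    obtain ⟨z, hz⟩ := hatu_min hu hpos (a • x + b • y)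
    rw [hz, mul_add, show ∀ r : ℝ, (a * t + b * s) * (r / (2 * (a * t + b * s))) = r / 2 by intro r; field_simp, norm_sub_sq_real]
    have h1 := mul_le_mul_of_nonneg_left (key t ht x z) ha
    have h2 := mul_le_mul_of_nonneg_left (key s hs y z) hb
    rw [inner_add_left, inner_smul_left, inner_smul_left]
    simp only [conj_trivial]
    have : ‖z‖ ^ 2 = a * ‖z‖ ^ 2 + b * ‖z‖ ^ 2 := by rw [← add_mul, hab, one_mul]
    nlinarith

lemma hatu_cont {n : ℕ} {u : EE n → ℝ} (hu : UniformContinuous u) :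
    ContinuousOn (fun p : ℝ × EE n => hatu n u p.1 p.2) {p | 0 < p.1} := by
  have h := (psi_concave hu).continuousOn (isOpen_lt continuous_const continuous_fst)
  have h2 : ContinuousOn (fun p : ℝ × EE n => ((p.1 * hatu n u p.1 p.2 - ‖p.2‖ ^ 2 / 2) +
      ‖p.2‖ ^ 2 / 2) / p.1) {p | 0 < p.1} := by
    refine ContinuousOn.div (h.add (by fun_prop)) (by fun_prop) ?_
    intro p hp; exact (ne_of_gt hp)
  refine h2.congr ?_
  intro p hp
  have : p.1 ≠ 0 := ne_of_gt hp
  simp only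
  field_simp
  ring

def Cal (n : ℕ) (u : EE n → ℝ) (t : ℝ) (x : EE n) (c : ℝ) (y : EE n) : Prop :=
  hatu n u t x + ‖y - x‖ ^ 2 / (2 * (c - t)) ≤ hatu n u c y

lemma cal_down {n : ℕ} {u : EE n → ℝ} (hu : UniformContinuous u) {t c d : ℝ} (ht : 0 ≤ t)
    (hc : t < c) (hd : c < d) {x y : EE n} (h : Cal n u t x d y) :
    Cal n u t x c (x + ((c - t) / (d - t)) • (y - x)) := by
  unfold Cal at *
  set w := x + ((c - t) / (d - t)) • (y - x) with hw
  have h1 := hatu_semi hu (ht.trans hc.le) hd w y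
  have hdt : 0 < d - t := by linarith
  have hct : 0 < c - t := by linarith
  have hdc : 0 < d - c := by linarith
  have e1 : w - x = ((c - t) / (d - t)) • (y - x) := by rw [hw]; abel
  have e2 : y - w = ((d - c) / (d - t)) • (y - x) := by
    have : y - w = (1 - (c - t) / (d - t)) • (y - x) := by
      rw [hw, sub_smul, one_smul]; abel
    rw [this]; congr 1; field_simp; ring
  have n1 : ‖w - x‖ ^ 2 / (2 * (c - t)) = (c - t) / (d - t) * (‖y - x‖ ^ 2 / (2 * (d - t))) := by
    rw [e1, norm_smul, Real.norm_of_nonneg (by positivity)]; field_simp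
  have n2 : ‖y - w‖ ^ 2 / (2 * (d - c)) = (d - c) / (d - t) * (‖y - x‖ ^ 2 / (2 * (d - t))) := by
    rw [e2, norm_smul, Real.norm_of_nonneg (by positivity)]; field_simp
  have n3 : ‖y - x‖ ^ 2 / (2 * (d - t)) = (c - t) / (d - t) * (‖y - x‖ ^ 2 / (2 * (d - t))) +
     (d - c) / (d - t) * (‖y - x‖ ^ 2 / (2 * (d - t))) := by
    rw [← add_mul, ← add_div]
    rw [show c - t + (d - c) = d - t by ring, div_self hdt.ne', one_mul]
  linarith

lemma cal_trans {n : ℕ} {u : EE n → ℝ} {t c d : ℝ}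
    (hc : t < c) (hd : c < d) {x y z : EE n} (h : Cal n u t x c y) (h' : Cal n u c y d z) :
    Cal n u t x d z := by
  unfold Cal at *
  have := key_le z y x (sub_pos.2 hd) (sub_pos.2 hc)
  rw [show d - c + (c - t) = d - t by ring] at this
  linarith

lemma squeeze_diff {V : Type*} [NormedAddCommGroup V] [NormedSpace ℝ V] {f g h : V → ℝ} {p : V}
    (hg : DifferentiableAt ℝ g p) (hh : DifferentiableAt ℝ h p)
    (h1 : ∀ᶠ q in nhds p, g q ≤ f q) (h2 : ∀ᶠ q in nhds p, f q ≤ h q)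
    (e1 : g p = f p) (e2 : h p = f p) : DifferentiableAt ℝ f p := by
  have hmin : IsLocalMin (fun q => h q - g q) p := by
    filter_upwards [h1, h2] with q a b
    rw [e1, e2]; linarith
  have h0 := hmin.hasFDerivAt_eq_zero (hh.hasFDerivAt.fun_sub hg.hasFDerivAt)
  have heq : fderiv ℝ h p = fderiv ℝ g p := sub_eq_zero.1 h0
  have H1 := hg.hasFDerivAt
  have H2 := hh.hasFDerivAt
  rw [heq] at H2
  refine HasFDerivAt.differentiableAt (f' := fderiv ℝ g p) ?_
  rw [hasFDerivAt_iff_isLittleO] at *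
  rw [Asymptotics.isLittleO_iff] at *
  intro c hc
  filter_upwards [h1, h2, H1 hc, H2 hc] with q a b c1 c2
  rw [Real.norm_eq_abs] at *
  rw [abs_le] at *
  rw [e1] at c1
  rw [e2] at c2
  constructor <;> linarith [c1.1, c2.2]

lemma cal_diff {n : ℕ} {u : EE n → ℝ} (hu : UniformContinuous u) {t c : ℝ} (ht : 0 < t)
    (hc : t < c) {x y : EE n} (h : Cal n u t x c y) :
    DifferentiableAt ℝ (fun q : ℝ × EE n => hatu n u q.1 q.2) (t, x) := by
  obtain ⟨z, hz⟩ := hatu_min hu ht x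
  have o1 : ∀ᶠ q : ℝ × EE n in nhds (t, x), 0 < q.1 :=
    (isOpen_lt continuous_const continuous_fst).mem_nhds ht
  have o2 : ∀ᶠ q : ℝ × EE n in nhds (t, x), q.1 < c :=
    (isOpen_lt continuous_fst continuous_const).mem_nhds hc
  refine squeeze_diff (g := fun q : ℝ × EE n => hatu n u c y - ‖y - q.2‖ ^ 2 / (2 * (c - q.1)))
    (h := fun q : ℝ × EE n => u z + ‖q.2 - z‖ ^ 2 / (2 * q.1)) ?_ ?_ ?_ ?_ ?_ ?_
  · have : DifferentiableAt ℝ (fun q : ℝ × EE n => ‖y - q.2‖ ^ 2) (t, x) := by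
      have d : DifferentiableAt ℝ (fun q : ℝ × EE n => y - q.2) (t, x) := by fun_prop
      exact d.norm_sq ℝ
    have d2 : DifferentiableAt ℝ (fun q : ℝ × EE n => 2 * (c - q.1)) (t, x) := by fun_prop
    simp only [div_eq_mul_inv]
    refine DifferentiableAt.const_sub (this.fun_mul (d2.fun_inv ?_)) _
    simp only; intro h0; linarith
  · have : DifferentiableAt ℝ (fun q : ℝ × EE n => ‖q.2 - z‖ ^ 2) (t, x) := by
      have d : DifferentiableAt ℝ (fun q : ℝ × EE n => q.2 - z) (t, x) := by fun_prop
      exact d.norm_sq ℝ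
    have d2 : DifferentiableAt ℝ (fun q : ℝ × EE n => 2 * q.1) (t, x) := by fun_prop
    simp only [div_eq_mul_inv]
    refine DifferentiableAt.const_add _ (this.fun_mul (d2.fun_inv ?_))
    simp only; intro h0; linarith
  · filter_upwards [o1, o2] with q a b
    have := hatu_semi hu a.le b q.2 y
    linarith
  · filter_upwards [o1, o2] with q a b
    exact hatu_le hu a _ _
  · have := hatu_semi hu ht.le hc x y
    unfold Cal at h
    simp only
    linarith
  · exact hz.symm

lemma touch_grad {n : ℕ} {f : EE n → ℝ} {y z : EE n} {k : ℝ} {L : EE n →L[ℝ] ℝ}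
    (hf : HasFDerivAt f L y)
    (h : ∀ w, f w - k * ‖w - z‖ ^ 2 ≤ f y - k * ‖y - z‖ ^ 2) :
    L = (2 * k) • innerSL ℝ (y - z) := by
  have h1 : HasFDerivAt (fun w : EE n => ‖w - z‖ ^ 2) (2 • (innerSL ℝ (y - z))) y := by
    have := (hasStrictFDerivAt_norm_sq (y - z)).hasFDerivAt.comp y ((hasFDerivAt_id y).sub_const z)
    simpa [Function.comp_def] using this
  have hmax : IsLocalMax (fun w => f w - k * ‖w - z‖ ^ 2) y := Filter.Eventually.of_forall h
  have h0 := hmax.hasFDerivAt_eq_zero (hf.fun_sub (h1.const_mul k))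
  rw [sub_eq_zero.1 h0]
  ext v
  simp
  ring

lemma diff_cal {n : ℕ} {u : EE n → ℝ} (hu : UniformContinuous u) {t c : ℝ} (ht : 0 < t)
    (hc : t < c) {x y : EE n}
    (hd : DifferentiableAt ℝ (fun q : ℝ × EE n => hatu n u q.1 q.2) (c, y))
    (hmax : ∀ w, hatu n u c w - ‖w - x‖ ^ 2 / (2 * (c - t)) ≤
      hatu n u c y - ‖y - x‖ ^ 2 / (2 * (c - t))) : Cal n u t x c y := by
  have hc0 := ht.trans hc
  have hct : 0 < c - t := by linarith
  obtain ⟨z, hz⟩ := hatu_min hu hc0 y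
  have hf : HasFDerivAt (fun w => hatu n u c w) _ y :=
    hd.hasFDerivAt.comp y (hasFDerivAt_prodMk_right c y)
  have g1 := touch_grad (z := z) (k := 1 / (2 * c)) hf (by
    intro w
    have := hatu_le hu hc0 w z
    rw [hz, one_div_mul_eq_div, one_div_mul_eq_div]; linarith)
  have g2 := touch_grad (z := x) (k := 1 / (2 * (c - t))) hf (by
    intro w
    have := hmax w
    rw [one_div_mul_eq_div, one_div_mul_eq_div]; linarith)
  rw [g1] at g2
  have g3 : (c - t) • (y - z) = c • (y - x) := by
    refine ext_inner_right ℝ fun v => ?_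
    have := congrArg (fun L : EE n →L[ℝ] ℝ => L v) g2
    simp only [smul_apply, innerSL_apply_apply, smul_eq_mul] at this
    rw [inner_smul_left, inner_smul_left]
    simp only [conj_trivial]
    field_simp at this
    linarith
  have g4 : t • (y - x) = (c - t) • (x - z) := by
    have e : y - z = (y - x) + (x - z) := by abel
    rw [e, smul_add] at g3
    have : (c - t) • (x - z) = c • (y - x) - (c - t) • (y - x) := by rw [← g3]; abel
    rw [this, ← sub_smul]; congr 1; ring
  have hk := key_id y x z hct ht
  rw [g4, sub_self, norm_zero, sub_add_cancel] at hk
  have := hatu_le hu ht x z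
  unfold Cal
  rw [hz]
  norm_num at hk
  linarith

lemma cal_aubry {n : ℕ} {u : EE n → ℝ} (hu : UniformContinuous u) {T t : ℝ} (ht : 0 < t)
    (htT : t < T) {x : EE n} (h : ∀ c, t < c → c < T → ∃ y, Cal n u t x c y) :
    (t, x) ∈ aubryT n u T := by
  obtain ⟨z, hz⟩ := hatu_min hu ht x
  have hC : Cal n u 0 z t x := by
    unfold Cal; rw [hatu_zero, hz, sub_zero]
  set v := (1 / t) • (x - z) with hv
  have hxz : x - z = t • v := by rw [hv, smul_smul, mul_one_div_cancel ht.ne', one_smul]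
  have A1 : ∀ c, t < c → c < T → Cal n u 0 z c (z + c • v) := by
    intro c hc hcT
    obtain ⟨y, hy⟩ := h c hc hcT
    have h1 := cal_trans ht hc hC hy
    have h2 := hatu_le hu (ht.trans hc) y z
    have h3 := key_eq y x z (sub_pos.2 hc) ht (by
      rw [sub_add_cancel]
      unfold Cal at hy
      linarith)
    have : y = z + c • v := by
      have e : y - x = (c - t) • v := by
        have e1 : t • (y - x) = t • ((c - t) • v) := by
          rw [h3, hxz, smul_comm]
        exact smul_right_injective _ ht.ne' e1
      have : y = (y - x) + (x - z) + z := by abel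
      rw [this, e, hxz, ← add_smul, add_comm]; congr 2; ring
    rwa [← this]
  have A2 : ∀ s, 0 ≤ s → s < T → hatu n u s (z + s • v) = u z + s * (1 / 2 * ‖v‖ ^ 2) := by
    intro s hs hsT
    rcases hs.eq_or_lt with rfl | hs
    · simp [hatu_zero]
    · have hl := hatu_le hu hs (z + s • v) z
      have hn : ‖z + s • v - z‖ ^ 2 / (2 * s) = s * (1 / 2 * ‖v‖ ^ 2) := by
        rw [add_sub_cancel_left, norm_smul, Real.norm_of_nonneg hs.le]; field_simp
      obtain ⟨c, hc1, hc2⟩ := exists_between (max_lt hsT htT)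
      obtain ⟨hsc, htc⟩ := max_lt_iff.1 hc1
      have hcal := cal_down hu le_rfl hs hsc (A1 c htc hc2)
      have e : z + ((s - 0) / (c - 0)) • (z + c • v - z) = z + s • v := by
        rw [add_sub_cancel_left, smul_smul, sub_zero, sub_zero, div_mul_cancel₀ _ (hs.trans hsc).ne']
      rw [e] at hcal
      unfold Cal at hcal
      rw [hatu_zero, sub_zero] at hcal
      rw [hn] at hcal hl
      linarith
  refine ⟨⟨ht, htT⟩, fun s => z + s • v, fun _ => v, ?_, continuousOn_const, ?_, ?_⟩
  · intro s _
    simpa using ((hasDerivAt_id s).smul_const v).const_add z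
  · simp only; rw [← hxz]; abel
  · intro a b ha hab hb
    simp only
    rw [A2 b (ha.trans hab.le) hb, A2 a ha (hab.trans hb), intervalIntegral.integral_const, smul_eq_mul]
    ring

lemma aubry_cal {n : ℕ} {u : EE n → ℝ} {T t : ℝ} {x : EE n}
    (h : (t, x) ∈ aubryT n u T) {c : ℝ} (hc : t < c) (hcT : c < T) : ∃ y, Cal n u t x c y := by
  obtain ⟨⟨ht, htT⟩, γ, γ', hd, hcont, hx, hcal⟩ := h
  simp only at ht htT hx
  refine ⟨γ c, ?_⟩
  unfold Cal
  rw [hcal t c ht.le hc hcT, hx]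
  have hct : 0 < c - t := by linarith
  have hsub : Set.uIcc t c ⊆ Set.Ico 0 T := by
    rw [Set.uIcc_of_le hc.le]
    intro s hs; exact ⟨ht.le.trans hs.1, hs.2.trans_lt hcT⟩
  set w := (1 / (c - t)) • (γ c - x) with hw
  have hγ : γ c - x = (c - t) • w := by rw [hw, smul_smul, mul_one_div_cancel hct.ne', one_smul]
  have hc' : ContinuousOn γ' (Set.uIcc t c) := hcont.mono hsub
  have I1 : ∫ s in t..c, inner ℝ w (γ' s) = inner ℝ w (γ c) - inner ℝ w (γ t) := by
    refine intervalIntegral.integral_eq_sub_of_hasDerivAt (f := fun s => inner ℝ w (γ s)) ?_ ?_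
    · intro s hs
      have := (innerSL ℝ w).hasFDerivAt.comp_hasDerivAt s (hd s (hsub hs))
      simpa [Function.comp_def] using this
    · exact (ContinuousOn.inner continuousOn_const hc').intervalIntegrable
  have I2 : ∫ s in t..c, (inner ℝ w (γ' s) - 1 / 2 * ‖w‖ ^ 2) ≤ ∫ s in t..c, 1 / 2 * ‖γ' s‖ ^ 2 := by
    refine intervalIntegral.integral_mono_on hc.le ?_ ?_ ?_
    · exact ((ContinuousOn.inner continuousOn_const hc').sub continuousOn_const).intervalIntegrable
    · exact (continuousOn_const.mul (hc'.norm.pow 2)).intervalIntegrable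
    · intro s _
      have := norm_sub_sq_real w (γ' s)
      have := sq_nonneg ‖w - γ' s‖
      linarith
  rw [intervalIntegral.integral_sub, I1, intervalIntegral.integral_const, smul_eq_mul, hx,
    ← inner_sub_right, hγ, inner_smul_right, real_inner_self_eq_norm_sq] at I2
  · rw [hγ, norm_smul, Real.norm_of_nonneg hct.le]
    have : ((c - t) * ‖w‖) ^ 2 / (2 * (c - t)) = (c - t) * (1 / 2 * ‖w‖ ^ 2) := by field_simp
    rw [this]
    linarith
  · exact (ContinuousOn.inner continuousOn_const hc').intervalIntegrable
  · exact continuousOn_const.intervalIntegrable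

lemma aubry_diff {n : ℕ} {u : EE n → ℝ} (hu : UniformContinuous u) {T t : ℝ} {x : EE n}
    (h : (t, x) ∈ aubryT n u T) :
    DifferentiableAt ℝ (fun q : ℝ × EE n => hatu n u q.1 q.2) (t, x) := by
  obtain ⟨c, h1, h2⟩ := exists_between h.1.2
  obtain ⟨y, hy⟩ := aubry_cal h h1 h2
  exact cal_diff hu h.1.1 h1 hy

lemma aubry_back {n : ℕ} {u : EE n → ℝ} (hu : UniformContinuous u) {T t c : ℝ} (ht : 0 < t)
    (hc : t < c) {x y : EE n} (h : (c, y) ∈ aubryT n u T)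
    (hmax : ∀ w, hatu n u c w - ‖w - x‖ ^ 2 / (2 * (c - t)) ≤
      hatu n u c y - ‖y - x‖ ^ 2 / (2 * (c - t))) : (t, x) ∈ aubryT n u T := by
  have hcT : c < T := h.1.2
  have h1 := diff_cal hu ht hc (aubry_diff hu h) hmax
  refine cal_aubry hu ht (hc.trans hcT) fun d hd hdT => ?_
  rcases lt_trichotomy d c with hdc | rfl | hdc
  · exact ⟨_, cal_down hu ht.le hd hdc h1⟩
  · exact ⟨_, h1⟩
  · obtain ⟨z, hz⟩ := aubry_cal h hdc hdT
    exact ⟨z, cal_trans hc hdc h1 hz⟩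

noncomputable def GG (n : ℕ) (u : EE n → ℝ) (p : ℝ × EE n × ℝ) (y : EE n) : ℝ :=
  p.2.2 * hatu n u (p.1 + p.2.2) y - ‖y - p.2.1‖ ^ 2 / 2

lemma GG_concave {n : ℕ} {u : EE n → ℝ} (hu : UniformContinuous u) {p : ℝ × EE n × ℝ}
    (hp : 0 < p.1) (hs : 0 ≤ p.2.2) {a b : ℝ} (ha : 0 ≤ a) (hb : 0 ≤ b) (hab : a + b = 1)
    (y z : EE n) :
    a * GG n u p y + b * GG n u p z + a * b * (p.1 / (p.1 + p.2.2)) * ‖y - z‖ ^ 2 / 2 ≤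
      GG n u p (a • y + b • z) := by
  obtain ⟨t, x, s⟩ := p
  simp only [GG] at *
  have hts : 0 < t + s := by linarith
  have hb' : b = 1 - a := by linarith
  have N1 : ‖a • y + b • z‖ ^ 2 = a * ‖y‖ ^ 2 + b * ‖z‖ ^ 2 - a * b * ‖y - z‖ ^ 2 := by
    rw [norm_add_sq_real, norm_sub_sq_real, norm_smul, norm_smul, inner_smul_left, inner_smul_right]
    simp only [mul_pow, Real.norm_eq_abs, sq_abs, conj_trivial]
    subst hb'; ring
  have N2 : ‖a • y + b • z - x‖ ^ 2 = a * ‖y - x‖ ^ 2 + b * ‖z - x‖ ^ 2 - a * b * ‖y - z‖ ^ 2 := by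
    rw [norm_sub_sq_real, N1, norm_sub_sq_real y x, norm_sub_sq_real z x, inner_add_left,
      inner_smul_left, inner_smul_left]
    simp only [conj_trivial]
    subst hb'; ring
  have h := (psi_concave hu).2 (x := (t + s, y)) hts (y := (t + s, z)) hts ha hb hab
  simp only [Prod.smul_mk, Prod.mk_add_mk, smul_eq_mul, ← add_mul, hab, one_mul] at h
  rw [N1] at h
  rw [N2]
  have h' : a * hatu n u (t + s) y + b * hatu n u (t + s) z - a * b * ‖y - z‖ ^ 2 / 2 / (t + s) ≤
      hatu n u (t + s) (a • y + b • z) := by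
    rw [sub_le_iff_le_add, ← sub_le_iff_le_add', le_div_iff₀ hts]
    linarith
  have h2 := mul_le_mul_of_nonneg_left h' hs
  have e : t / (t + s) = 1 - s / (t + s) := by field_simp; ring
  rw [e]
  have e2 : s * (a * hatu n u (t + s) y + b * hatu n u (t + s) z - a * b * ‖y - z‖ ^ 2 / 2 / (t + s))
    = s * (a * hatu n u (t + s) y + b * hatu n u (t + s) z) -
      a * b * (s / (t + s)) * ‖y - z‖ ^ 2 / 2 := by ring
  rw [e2] at h2
  linarith

lemma GG_cont {n : ℕ} {u : EE n → ℝ} (hu : UniformContinuous u) :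
    ContinuousOn (fun q : (ℝ × EE n × ℝ) × EE n => GG n u q.1 q.2)
      {q | 0 < q.1.1 + q.1.2.2} := by
  unfold GG
  have : ContinuousOn (fun q : (ℝ × EE n × ℝ) × EE n => hatu n u (q.1.1 + q.1.2.2) q.2)
      {q | 0 < q.1.1 + q.1.2.2} :=
    (hatu_cont hu).comp (f := fun q : (ℝ × EE n × ℝ) × EE n => (q.1.1 + q.1.2.2, q.2))
      (by fun_prop) (fun q hq => hq)
  refine ContinuousOn.sub (ContinuousOn.mul (by fun_prop) this) (by fun_prop)

lemma GG_max {n : ℕ} {u : EE n → ℝ} (hu : UniformContinuous u) (p : ℝ × EE n × ℝ)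
    (hp : 0 < p.1) (hs : 0 ≤ p.2.2) : ∃ y, ∀ w, GG n u p w ≤ GG n u p y := by
  have hts : 0 < p.1 + p.2.2 := by linarith
  have hc : Continuous (fun y => - GG n u p y) := by
    refine Continuous.neg ?_
    have := (GG_cont hu).comp (f := fun y : EE n => (p, y)) (s := Set.univ) (by fun_prop)
      (fun _ _ => hts)
    exact continuousOn_univ.1 this
  obtain ⟨A, B, hA, hB, h⟩ := hatu_growth hu
  obtain ⟨y, hy⟩ := coercive_min hc p.2.1 (a := 1 / 2) (b := p.2.2 * B)
    (c := p.2.2 * (A + hatu n u (p.1 + p.2.2) p.2.1)) (by norm_num) (by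
      intro w
      unfold GG
      have := mul_le_mul_of_nonneg_left (h _ hts w p.2.1) hs
      rw [norm_sub_rev p.2.1 w]
      linarith)
  exact ⟨y, fun w => by have := hy w; linarith⟩

lemma GG_lt {n : ℕ} {u : EE n → ℝ} (hu : UniformContinuous u) (p : ℝ × EE n × ℝ)
    (hp : 0 < p.1) (hs : 0 ≤ p.2.2) {y w : EE n} (hy : ∀ w, GG n u p w ≤ GG n u p y) (hw : w ≠ y) :
    GG n u p w < GG n u p y := by
  by_contra hlt
  push Not at hlt
  have h1 := GG_concave hu hp hs (a := 1 / 2) (b := 1 / 2) (by norm_num) (by norm_num) (by norm_num) w y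
  have h2 := hy ((1 / 2 : ℝ) • w + (1 / 2 : ℝ) • y)
  have h3 : 0 < ‖w - y‖ := norm_pos_iff.2 (sub_ne_zero.2 hw)
  have h4 : 0 < 1 / 2 * (1 / 2) * (p.1 / (p.1 + p.2.2)) * ‖w - y‖ ^ 2 / 2 := by positivity
  linarith

open Classical in
noncomputable def YY (n : ℕ) (u : EE n → ℝ) (p : ℝ × EE n × ℝ) : EE n :=
  if h : ∃ y, ∀ w, GG n u p w ≤ GG n u p y then h.choose else 0

lemma YY_max {n : ℕ} {u : EE n → ℝ} (hu : UniformContinuous u) (p : ℝ × EE n × ℝ)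
    (hp : 0 < p.1) (hs : 0 ≤ p.2.2) (w : EE n) : GG n u p w ≤ GG n u p (YY n u p) := by
  have h := GG_max hu p hp hs
  rw [YY, dif_pos h]
  exact h.choose_spec w

lemma YY_zero {n : ℕ} {u : EE n → ℝ} (hu : UniformContinuous u) {t : ℝ} (ht : 0 < t) (x : EE n) :
    YY n u (t, x, 0) = x := by
  have h := YY_max hu (t, x, 0) ht le_rfl x
  simp only [GG, zero_mul, sub_self, norm_zero] at h
  have h2 : ‖YY n u (t, x, 0) - x‖ = 0 := by
    have := sq_nonneg ‖YY n u (t, x, 0) - x‖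
    exact pow_eq_zero_iff (two_ne_zero) |>.1 (by linarith)
  exact sub_eq_zero.1 (norm_eq_zero.1 h2)

lemma YY_max' {n : ℕ} {u : EE n → ℝ} (hu : UniformContinuous u) {t c : ℝ} (ht : 0 < t) (hc : t < c)
    (x w : EE n) : hatu n u c w - ‖w - x‖ ^ 2 / (2 * (c - t)) ≤
      hatu n u c (YY n u (t, x, c - t)) - ‖YY n u (t, x, c - t) - x‖ ^ 2 / (2 * (c - t)) := by
  have h := YY_max hu (t, x, c - t) ht (sub_nonneg.2 hc.le) w
  have hct : 0 < c - t := by linarith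
  simp only [GG, add_sub_cancel] at h
  set Y := YY n u (t, x, c - t)
  have e : ∀ r v : ℝ, r - v / (2 * (c - t)) = ((c - t) * r - v / 2) / (c - t) := by
    intro r v; field_simp
  rw [e, e]
  gcongr

lemma YY_cont {n : ℕ} {u : EE n → ℝ} (hu : UniformContinuous u) :
    ContinuousOn (YY n u) {p | 0 < p.1 ∧ 0 ≤ p.2.2} := by
  intro p hp
  rw [ContinuousWithinAt, Metric.tendsto_nhds]
  intro ε hε
  set y0 := YY n u p
  have hpt : 0 < p.1 + p.2.2 := by linarith [hp.1, hp.2]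
  have hev : ∀ᶠ q in nhds p, ∀ y ∈ Metric.sphere y0 ε, GG n u q y < GG n u q y0 := by
    refine (isCompact_sphere y0 ε).eventually_forall_of_forall_eventually
      (P := fun q y => GG n u q y < GG n u q y0) ?_
    intro y hy
    have hne : y ≠ y0 := by rintro rfl; simp at hy; linarith
    have hlt := GG_lt hu p hp.1 hp.2 (YY_max hu p hp.1 hp.2) hne
    have hopen : IsOpen {q : (ℝ × EE n × ℝ) × EE n | 0 < q.1.1 + q.1.2.2} :=
      isOpen_lt continuous_const (by fun_prop)
    have c1 : ContinuousAt (fun q : (ℝ × EE n × ℝ) × EE n => GG n u q.1 q.2) (p, y) :=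
      (GG_cont hu).continuousAt (hopen.mem_nhds hpt)
    have c2 : ContinuousAt (fun q : (ℝ × EE n × ℝ) × EE n => GG n u q.1 q.2) (p, y0) :=
      (GG_cont hu).continuousAt (hopen.mem_nhds hpt)
    have c3 : ContinuousAt (fun q : (ℝ × EE n × ℝ) × EE n => GG n u q.1 y0) (p, y) :=
      ContinuousAt.comp (g := fun q : (ℝ × EE n × ℝ) × EE n => GG n u q.1 q.2)
        (f := fun q : (ℝ × EE n × ℝ) × EE n => (q.1, y0)) c2 (by fun_prop)
    exact c1.eventually_lt c3 hlt
  filter_upwards [mem_nhdsWithin_of_mem_nhds hev, self_mem_nhdsWithin] with q hq hqD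
  by_contra hge
  push Not at hge
  set y1 := YY n u q
  rw [dist_eq_norm] at hge
  have hpos : 0 < ‖y1 - y0‖ := hε.trans_le hge
  set r := ε / ‖y1 - y0‖ with hr
  have hr0 : 0 < r := by positivity
  have hr1 : r ≤ 1 := (div_le_one hpos).2 hge
  have h1 := hq (r • y1 + (1 - r) • y0) (by
    rw [mem_sphere_iff_norm]
    have : r • y1 + (1 - r) • y0 - y0 = r • (y1 - y0) := by
      rw [sub_smul, one_smul, smul_sub]; abel
    rw [this, norm_smul, Real.norm_of_nonneg hr0.le, hr, div_mul_cancel₀ _ hpos.ne'])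
  have h2 := GG_concave hu hqD.1 hqD.2 hr0.le (sub_nonneg.2 hr1) (by ring) y1 y0
  have h3 := YY_max hu q hqD.1 hqD.2 y0
  have h4 : 0 ≤ r * (1 - r) * (q.1 / (q.1 + q.2.2)) * ‖y1 - y0‖ ^ 2 / 2 := by
    have := hqD.1
    have := hqD.2
    have := sub_nonneg.2 hr1
    positivity
  have h5 := mul_le_mul_of_nonneg_left h3 hr0.le
  change r * GG n u q y0 ≤ r * GG n u q y1 at h5
  linarith

lemma not_cal_open {n : ℕ} {u : EE n → ℝ} (hu : UniformContinuous u) {t c : ℝ} {x : EE n}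
    (ht : 0 < t) (hc : t < c) (h : ∀ y, ¬ Cal n u t x c y) :
    ∀ᶠ p : ℝ × EE n in nhds (t, x), ∀ y, ¬ Cal n u p.1 p.2 c y := by
  have hO : IsOpen {p : ℝ × EE n | 0 < p.1 ∧ p.1 < c} :=
    (isOpen_lt continuous_const continuous_fst).inter (isOpen_lt continuous_fst continuous_const)
  have hmem : {p : ℝ × EE n | 0 < p.1 ∧ p.1 < c} ∈ nhds (t, x) := hO.mem_nhds ⟨ht, hc⟩
  have cY : ContinuousOn (fun p : ℝ × EE n => YY n u (p.1, p.2, c - p.1))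
      {p | 0 < p.1 ∧ p.1 < c} :=
    (YY_cont hu).comp (f := fun p : ℝ × EE n => (p.1, p.2, c - p.1)) (by fun_prop)
      (fun p hp => ⟨hp.1, sub_nonneg.2 hp.2.le⟩)
  have cU : ContinuousOn (fun p : ℝ × EE n => hatu n u c (YY n u (p.1, p.2, c - p.1)))
      {p | 0 < p.1 ∧ p.1 < c} :=
    (hatu_cont hu).comp (f := fun p : ℝ × EE n => (c, YY n u (p.1, p.2, c - p.1)))
      (continuousOn_const.prodMk cY) (fun p hp => hp.1.trans hp.2)
  have c1 : ContinuousOn (fun p : ℝ × EE n => hatu n u c (YY n u (p.1, p.2, c - p.1)) -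
      ‖YY n u (p.1, p.2, c - p.1) - p.2‖ ^ 2 / (2 * (c - p.1))) {p | 0 < p.1 ∧ p.1 < c} := by
    refine cU.sub (ContinuousOn.div ((cY.sub continuousOn_snd).norm.pow 2) (by fun_prop) ?_)
    intro p hp
    have := hp.2
    intro h0
    linarith
  have c2 : ContinuousOn (fun p : ℝ × EE n => hatu n u p.1 p.2) {p | 0 < p.1 ∧ p.1 < c} :=
    (hatu_cont hu).mono fun p hp => hp.1
  have hlt := h (YY n u (t, x, c - t))
  unfold Cal at hlt
  push Not at hlt
  filter_upwards [(c1.continuousAt hmem).eventually_lt (c2.continuousAt hmem)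
    (by simp only; linarith), hmem] with p hp hp2 y hy
  have := YY_max' hu hp2.1 hp2.2 p.2 y
  unfold Cal at hy
  linarith

lemma exists_alpha {n : ℕ} {u : EE n → ℝ} (hu : UniformContinuous u) (T : ℝ) :
    ∃ α : C(({p : ℝ × EE n | p.1 ∈ Set.Ioo 0 T} \ aubryT n u T : Set (ℝ × EE n)), ℝ),
      ∀ y, α y ∈ {c : ℝ | (y.1.1 < c ∧ c < T) ∧ ∀ z, ¬ Cal n u y.1.1 y.1.2 c z} := by
  refine exists_continuous_forall_mem_convex_of_local_const ?_ ?_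
  · intro y
    refine Set.OrdConnected.convex ⟨?_⟩
    rintro a ⟨ha, ha'⟩ b ⟨hb, hb'⟩ c ⟨hac, hcb⟩
    refine ⟨⟨ha.1.trans_le hac, hcb.trans_lt hb.2⟩, fun z hz => ?_⟩
    rcases hac.eq_or_lt with rfl | hac
    · exact ha' _ hz
    · exact ha' _ (cal_down hu y.2.1.1.le ha.1 hac hz)
  · intro y
    have : ∃ c, y.1.1 < c ∧ c < T ∧ ∀ z, ¬ Cal n u y.1.1 y.1.2 c z := by
      by_contra hcon
      push Not at hcon
      exact y.2.2 (cal_aubry hu y.2.1.1 y.2.1.2 hcon)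
    obtain ⟨c, h1, h2, h3⟩ := this
    refine ⟨c, ?_⟩
    have e1 := not_cal_open hu y.2.1.1 h1 h3
    have e2 : ∀ᶠ p : ℝ × EE n in nhds y.1, p.1 < c :=
      (isOpen_lt continuous_fst continuous_const).mem_nhds h1
    have e3 := continuous_subtype_val.continuousAt.eventually (e1.and e2)
    filter_upwards [e3] with p hp
    exact ⟨⟨hp.2, h2⟩, hp.1⟩

/-- For `u` uniformly continuous, the inclusion
`Σ_T(û) ⊆ ((0,T) × ℝⁿ) \ ℐ_T(û)` is a homotopy equivalence. -/
theorem sigmaT_inclusion_homotopyEquiv (n : ℕ)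
    (u : EuclideanSpace ℝ (Fin n) → ℝ) (hu : UniformContinuous u) (T : ℝ) (hT : 0 < T) :
    sigmaT n u T ⊆
      ({p : ℝ × EuclideanSpace ℝ (Fin n) | p.1 ∈ Set.Ioo 0 T} \ aubryT n u T) ∧
    InclusionIsHomotopyEquiv
      {y : ({p : ℝ × EuclideanSpace ℝ (Fin n) | p.1 ∈ Set.Ioo 0 T} \ aubryT n u T :
          Set (ℝ × EuclideanSpace ℝ (Fin n))) |
        (y : ℝ × EuclideanSpace ℝ (Fin n)) ∈ sigmaT n u T} := by
  have hsub : sigmaT n u T ⊆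
      ({p : ℝ × EuclideanSpace ℝ (Fin n) | p.1 ∈ Set.Ioo 0 T} \ aubryT n u T) :=
    fun p hp => ⟨hp.1, fun hA => hp.2 (aubry_diff hu hA)⟩
  refine ⟨hsub, ?_⟩
  obtain ⟨α, hα⟩ := exists_alpha hu T
  have htα : ∀ y : ({p : ℝ × EE n | p.1 ∈ Set.Ioo 0 T} \ aubryT n u T :
      Set (ℝ × EE n)), y.1.1 < α y := fun y => (hα y).1.1
  have hαT : ∀ y : ({p : ℝ × EE n | p.1 ∈ Set.Ioo 0 T} \ aubryT n u T :
      Set (ℝ × EE n)), α y < T := fun y => (hα y).1.2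
  -- the deformation
  let F : (({p : ℝ × EE n | p.1 ∈ Set.Ioo 0 T} \ aubryT n u T : Set (ℝ × EE n))) × unitInterval →
      ℝ × EE n := fun q => (q.1.1.1 + q.2.1 * (α q.1 - q.1.1.1),
        YY n u (q.1.1.1, q.1.1.2, q.2.1 * (α q.1 - q.1.1.1)))
  have hF0 : ∀ y, F (y, 0) = y.1 := by
    intro y
    refine Prod.ext ?_ ?_
    · simp [F]
    · simp only [F]
      simp only [Set.Icc.coe_zero, zero_mul]
      exact YY_zero hu y.2.1.1 _
  have hFc : Continuous F := by
    refine Continuous.prodMk (by fun_prop) ?_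
    refine (YY_cont hu).comp_continuous (f := fun q : (({p : ℝ × EE n | p.1 ∈ Set.Ioo 0 T} \
      aubryT n u T : Set (ℝ × EE n))) × unitInterval =>
        (q.1.1.1, q.1.1.2, q.2.1 * (α q.1 - q.1.1.1))) (by fun_prop) ?_
    intro q
    exact ⟨q.1.2.1.1, mul_nonneg q.2.2.1 (sub_nonneg.2 (htα q.1).le)⟩
  have hFt : ∀ q, (F q).1 ∈ Set.Ioo 0 T := by
    intro q
    have h1 := htα q.1
    have h2 := hαT q.1
    have h3 : 0 < q.1.1.1 := q.1.2.1.1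
    have h4 := mul_nonneg q.2.2.1 (sub_nonneg.2 h1.le)
    have h5 := mul_le_mul_of_nonneg_right q.2.2.2 (sub_nonneg.2 h1.le)
    simp only [F]
    exact ⟨by linarith, by linarith⟩
  -- positive times
  have hFpos : ∀ q, q.2 ≠ 0 → q.1.1.1 < (F q).1 ∧
      (F q).2 = YY n u (q.1.1.1, q.1.1.2, (F q).1 - q.1.1.1) := by
    intro q hq
    have h1 := htα q.1
    have hq0 : 0 < q.2.1 := lt_of_le_of_ne q.2.2.1 fun h => hq (Subtype.ext h.symm)
    have h4 := mul_pos hq0 (sub_pos.2 h1)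
    refine ⟨by simp only [F]; linarith, ?_⟩
    simp only [F, add_sub_cancel_left]
  have hFY : ∀ q, F q ∈ ({p : ℝ × EE n | p.1 ∈ Set.Ioo 0 T} \ aubryT n u T : Set (ℝ × EE n)) := by
    intro q
    refine ⟨hFt q, fun hA => ?_⟩
    by_cases hq : q.2 = 0
    · have : q = (q.1, 0) := Prod.ext rfl hq
      rw [this, hF0] at hA
      exact q.1.2.2 hA
    · obtain ⟨h1, h2⟩ := hFpos q hq
      refine q.1.2.2 (aubry_back hu q.1.2.1.1 h1 (y := (F q).2) hA fun w => ?_)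
      rw [h2]
      exact YY_max' hu q.1.2.1.1 h1 _ w
  have hFcal : ∀ q, q.2 ≠ 0 →
      DifferentiableAt ℝ (fun q : ℝ × EE n => hatu n u q.1 q.2) (F q) →
      Cal n u q.1.1.1 q.1.1.2 (F q).1 (F q).2 := by
    intro q hq hd
    obtain ⟨h1, h2⟩ := hFpos q hq
    refine diff_cal hu q.1.2.1.1 h1 hd fun w => ?_
    rw [h2]
    exact YY_max' hu q.1.2.1.1 h1 _ w
  have hFS : ∀ q, q.1.1 ∈ sigmaT n u T → F q ∈ sigmaT n u T := by
    intro q hS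
    by_cases hq : q.2 = 0
    · have : q = (q.1, 0) := Prod.ext rfl hq
      rw [this, hF0]
      exact hS
    · refine ⟨hFt q, fun hd => hS.2 ?_⟩
      exact cal_diff hu q.1.2.1.1 (hFpos q hq).1 (hFcal q hq hd)
  have hF1 : ∀ y, F (y, 1) ∈ sigmaT n u T := by
    intro y
    refine ⟨hFt _, fun hd => ?_⟩
    have := hFcal (y, 1) one_ne_zero hd
    have e : (F (y, 1)).1 = α y := by simp [F]
    rw [e] at this
    exact (hα y).2 _ this
  refine ⟨⟨fun y => ⟨⟨F (y, 1), hFY _⟩, hF1 y⟩, ?_⟩, ?_, ?_⟩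
  · exact Continuous.subtype_mk (Continuous.subtype_mk (hFc.comp (by fun_prop)) _) _
  · refine ContinuousMap.Homotopic.symm ⟨⟨⟨fun q => ⟨⟨F (q.2.1, q.1), hFY _⟩, hFS _ q.2.2⟩, ?_⟩, ?_, ?_⟩⟩
    · exact Continuous.subtype_mk (Continuous.subtype_mk (hFc.comp (by fun_prop)) _) _
    · intro x
      exact Subtype.ext (Subtype.ext (hF0 x.1))
    · intro x
      rfl
  · refine ContinuousMap.Homotopic.symm ⟨⟨⟨fun q => ⟨F (q.2, q.1), hFY _⟩, ?_⟩, ?_, ?_⟩⟩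
    · exact Continuous.subtype_mk (hFc.comp (by fun_prop)) _
    · intro x
      exact Subtype.ext (hF0 x)
    · intro x
      rfl
end
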